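/- Under the local blowup setup with simple blowup, suppose the limit energies σ_i := lim_{k→∞} (1/2π)∫_{B_δ} h_i^k |x|^{2γ} e^{ũ_i^k} dx exist for i = 1,…,n. Then, even if some components σ_i are zero, the vector (σ_1,…,σ_n) satisfies the Pohozaev identity Σ_{i,j=1}^n a_{ij} σ_i σ_j = 4(1+γ) Σ_{i=1}^n σ_i. -/

import Mathlib

open MeasureTheory Metric Filter

noncomputable section

/-- The plane `ℝ²`. -/
abbrev E2 := EuclideanSpace ℝ (Fin 2)

/-- An n×n real matrix `A` satisfies (H1) if it is symmetric, has all entries nonnegative,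
is irreducible, and is invertible. -/
def H1 {n : ℕ} (A : Matrix (Fin n) (Fin n) ℝ) : Prop :=
  A.IsSymm ∧ (∀ i j, 0 ≤ A i j) ∧
  (¬ ∃ S : Finset (Fin n), S.Nonempty ∧ Sᶜ.Nonempty ∧ ∀ i ∈ S, ∀ j ∈ Sᶜ, A i j = 0) ∧
  IsUnit A.det

/-- An n×n real matrix `A` satisfies (H2) if its inverse `A⁻¹ = (aⁱʲ)` satisfies
`aⁱⁱ ≤ 0`, `aⁱʲ ≥ 0` for `i ≠ j`, and all row sums of `A⁻¹` are nonnegative. -/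
def H2 {n : ℕ} (A : Matrix (Fin n) (Fin n) ℝ) : Prop :=
  (∀ i, A⁻¹ i i ≤ 0) ∧ (∀ i j, i ≠ j → 0 ≤ A⁻¹ i j) ∧ (∀ i, 0 ≤ ∑ j, A⁻¹ i j)

/-- The Laplacian of a function on the plane, as the sum of its pure second derivatives
in the coordinate directions. -/
def lap (f : E2 → ℝ) (x : E2) : ℝ :=
  ∑ i : Fin 2, fderiv ℝ (fun y => fderiv ℝ f y (EuclideanSpace.single i 1)) x
    (EuclideanSpace.single i 1)

/-- The local blowup setup of the paper: `ũᵏ = u` is a sequence of solutions of the singular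
Liouville system `Δũᵢᵏ + Σⱼ aᵢⱼ |x|^{2γ} hⱼᵏ e^{ũⱼᵏ} = 0` on the ball `B_δ ⊂ ℝ²`, with
uniformly bounded positive `C¹` coefficient functions `hᵢᵏ`, uniformly bounded energy,
uniformly bounded boundary oscillation, blowup `M_k := (1/μ) maxᵢ max_{B_δ} ũᵢᵏ → ∞`
(`μ = 1 + γ`), and no blowup away from the origin. -/
structure LocalBlowupSetup (n : ℕ) (δ γ : ℝ) (A : Matrix (Fin n) (Fin n) ℝ)
    (h u : ℕ → Fin n → E2 → ℝ) (M : ℕ → ℝ) where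
  /-- uniform lower bound for the coefficient functions -/
  c₁ : ℝ
  /-- uniform upper bound for the coefficient functions -/
  c₂ : ℝ
  /-- uniform `C¹` bound for the coefficient functions -/
  c₃ : ℝ
  /-- uniform energy/oscillation bound -/
  C : ℝ
  hn : 0 < n
  hδ : 0 < δ
  hγ : -1 < γ
  hH1 : H1 A
  hH2 : H2 A
  c₁_pos : 0 < c₁
  h_lb : ∀ k i, ∀ x ∈ closedBall (0:E2) δ, c₁ ≤ h k i x
  h_ub : ∀ k i, ∀ x ∈ closedBall (0:E2) δ, h k i x ≤ c₂
  h_c1 : ∀ k i, ContDiffOn ℝ 1 (h k i) (closedBall (0:E2) δ)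
  h_grad : ∀ k i, ∀ x ∈ closedBall (0:E2) δ,
    ‖fderivWithin ℝ (h k i) (closedBall (0:E2) δ) x‖ ≤ c₃
  u_cont : ∀ k i, ContinuousOn (u k i) (closedBall (0:E2) δ)
  u_c2 : ∀ k i, ContDiffOn ℝ 2 (u k i) (ball (0:E2) δ \ {0})
  pde : ∀ k i, ∀ x ∈ ball (0:E2) δ \ {0},
    lap (u k i) x + ∑ j, A i j * (‖x‖ ^ (2*γ) * (h k j x * Real.exp (u k j x))) = 0
  energy : ∀ k i, ∫ x in closedBall (0:E2) δ, ‖x‖ ^ (2*γ) * (h k i x * Real.exp (u k i x)) ≤ C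
  osc : ∀ k i, ∀ x ∈ sphere (0:E2) δ, ∀ y ∈ sphere (0:E2) δ, |u k i x - u k i y| ≤ C
  M_attained : ∀ k, ∃ i, ∃ x ∈ closedBall (0:E2) δ, u k i x = (1+γ) * M k
  M_max : ∀ k i, ∀ x ∈ closedBall (0:E2) δ, u k i x ≤ (1+γ) * M k
  M_inf : Tendsto M atTop atTop
  no_blowup_away : ∀ ε, 0 < ε → ε < δ → ∃ Cε : ℝ, ∀ k i, ∀ x ∈ closedBall (0:E2) δ,
    ε ≤ ‖x‖ → u k i x + 2*γ*Real.log ‖x‖ ≤ Cε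

/-- The blowup is simple if `ũᵢᵏ(x) + 2μ log|x|` is bounded above uniformly. -/
def SimpleBlowup {n : ℕ} (δ γ : ℝ) (u : ℕ → Fin n → E2 → ℝ) : Prop :=
  ∃ C : ℝ, ∀ k i, ∀ x ∈ closedBall (0:E2) δ, x ≠ 0 →
    u k i x + 2*(1+γ)*Real.log ‖x‖ ≤ C

/-- Differentiation under the integral sign over a period. -/
lemma hasDerivAt_integral_period {T₀ : ℝ} {f f' : ℝ → ℝ → ℝ}
    (hf : ∀ t < T₀, Continuous (f t))
    (hd : ∀ t < T₀, ∀ q, HasDerivAt (fun s => f s q) (f' t q) t)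
    (hc : ContinuousOn (Function.uncurry f') (Set.Iio T₀ ×ˢ Set.univ)) {t : ℝ} (ht : t < T₀) :
    HasDerivAt (fun s => ∫ q in (0:ℝ)..(2 * Real.pi), f s q)
      (∫ q in (0:ℝ)..(2 * Real.pi), f' t q) t := by
  set ε := (T₀ - t) / 2 with hε
  have hεpos : 0 < ε := by rw [hε]; linarith
  have hsub : Set.Icc (t - ε) (t + ε) ×ˢ Set.Icc 0 (2 * Real.pi) ⊆
      Set.Iio T₀ ×ˢ (Set.univ : Set ℝ) := by
    rintro ⟨s, q⟩ ⟨⟨_, h2⟩, _⟩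
    exact ⟨by simp only [Set.mem_Iio]; simp only at h2; rw [hε] at h2; linarith, trivial⟩
  obtain ⟨B, hB⟩ := (isCompact_Icc.prod isCompact_Icc).exists_bound_of_continuousOn
    (hc.mono hsub)
  have hslice : Continuous (f' t) := by
    have : ContinuousOn (fun q : ℝ => Function.uncurry f' (t, q)) Set.univ :=
      hc.comp (by fun_prop) (fun q _ => ⟨ht, trivial⟩)
    exact continuousOn_univ.mp this
  refine (intervalIntegral.hasDerivAt_integral_of_dominated_loc_of_deriv_le
    (F := f) (F' := f') (bound := fun _ => B) (s := Set.Ioo (t - ε) (t + ε))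
    (Ioo_mem_nhds (by linarith) (by linarith)) ?_ ?_ ?_ ?_ ?_ ?_).2
  · filter_upwards [Iio_mem_nhds ht] with s hs
    exact (hf s hs).aestronglyMeasurable
  · exact (hf t ht).intervalIntegrable _ _
  · exact hslice.aestronglyMeasurable
  · refine Eventually.of_forall fun q hq s hs => hB (s, q) ⟨⟨hs.1.le, hs.2.le⟩, ?_⟩
    rw [Set.uIoc_of_le (by positivity)] at hq
    exact ⟨hq.1.le, hq.2⟩
  · exact intervalIntegrable_const
  · refine Eventually.of_forall fun q _ s hs => hd s ?_ q
    have := hs.2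
    rw [hε] at this
    linarith

/-- Second derivative test at an interior maximum. -/
lemma second_deriv_nonpos_of_isLocalMax {f f' : ℝ → ℝ} {f'' x : ℝ} (hmax : IsLocalMax f x)
    (hf : ∀ᶠ y in nhds x, HasDerivAt f (f' y) y) (hf' : HasDerivAt f' f'' x) : f'' ≤ 0 := by
  by_contra! hpos
  have hderiv : deriv f =ᶠ[nhds x] f' := hf.mono fun y hy => hy.deriv
  have h2 : deriv (deriv f) x = f'' := by rw [hderiv.deriv_eq]; exact hf'.deriv
  have hmin : IsLocalMin f x := isLocalMin_of_deriv_deriv_pos (by rw [h2]; exact hpos)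
    hmax.deriv_eq_zero hf.self_of_nhds.continuousAt
  have hconst : f =ᶠ[nhds x] fun _ => f x := by
    filter_upwards [hmax, hmin] with y h1 h3 using le_antisymm h1 h3
  have h3 : deriv f =ᶠ[nhds x] fun _ => 0 := by
    filter_upwards [hconst.eventuallyEq_nhds] with y hy
    rw [hy.deriv_eq]; simp
  have h4 : deriv (deriv f) x = 0 := by rw [h3.deriv_eq]; simp
  linarith

/-- Maximum principle on a rectangle `[a, b] × [0, π]`, with exponential decay of the influence
of the boundary data on the sides `t = a` and `t = b`. -/
lemma rectangle_max_principle {a b K η : ℝ} (hab : a < b) (hK : 0 ≤ K) (hη : 0 < η)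
    {v vt vtt vq vqq : ℝ → ℝ → ℝ}
    (hc : ContinuousOn (Function.uncurry v) (Set.Icc a b ×ˢ Set.Icc 0 Real.pi))
    (ht : ∀ t ∈ Set.Ioo a b, ∀ q ∈ Set.Ioo 0 Real.pi, HasDerivAt (fun s => v s q) (vt t q) t)
    (htt : ∀ t ∈ Set.Ioo a b, ∀ q ∈ Set.Ioo 0 Real.pi, HasDerivAt (fun s => vt s q) (vtt t q) t)
    (hq : ∀ t ∈ Set.Ioo a b, ∀ q ∈ Set.Ioo 0 Real.pi, HasDerivAt (fun s => v t s) (vq t q) q)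
    (hqq : ∀ t ∈ Set.Ioo a b, ∀ q ∈ Set.Ioo 0 Real.pi, HasDerivAt (fun s => vq t s) (vqq t q) q)
    (hlap : ∀ t ∈ Set.Ioo a b, ∀ q ∈ Set.Ioo 0 Real.pi, -η ≤ vtt t q + vqq t q)
    (h0 : ∀ t ∈ Set.Icc a b, v t 0 ≤ 0) (hpi : ∀ t ∈ Set.Icc a b, v t Real.pi ≤ 0)
    (ha : ∀ q ∈ Set.Icc 0 Real.pi, v a q ≤ K) (hb : ∀ q ∈ Set.Icc 0 Real.pi, v b q ≤ K)
    {t q : ℝ} (htm : t ∈ Set.Icc a b) (hqm : q ∈ Set.Icc 0 Real.pi) :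
    v t q ≤ 2 * K * Real.cosh ((t - (a + b) / 2) / 2) / Real.cosh ((b - a) / 4) + 2 * η := by
  have hpos := Real.pi_pos
  set m := (a + b) / 2 with hm
  set D := Real.cosh ((b - a) / 4) with hD
  have hDpos : 0 < D := Real.cosh_pos _
  set κ := 2 * K / D with hκ
  have hκ0 : 0 ≤ κ := by positivity
  set bar : ℝ → ℝ → ℝ := fun t q => κ * (Real.cos ((q - Real.pi / 2) / 2) *
    Real.cosh ((t - m) / 2)) + (3 / 2 * η) * (q * (Real.pi - q) / 2) with hbar
  have hcos : ∀ q ∈ Set.Icc 0 Real.pi, 1 / 2 ≤ Real.cos ((q - Real.pi / 2) / 2) := by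
    intro q hq
    rw [← Real.cos_pi_div_three, ← Real.cos_abs ((q - Real.pi / 2) / 2)]
    apply Real.cos_le_cos_of_nonneg_of_le_pi (abs_nonneg _) (by linarith)
    rw [abs_le]; constructor <;> linarith [hq.1, hq.2]
  have hbar0 : ∀ t, ∀ q ∈ Set.Icc 0 Real.pi, 0 ≤ bar t q := by
    intro t q hq
    have h1 := hcos q hq
    have h2 := Real.cosh_pos ((t - m) / 2)
    have h3 : 0 ≤ q * (Real.pi - q) := mul_nonneg hq.1 (by linarith [hq.2])
    simp only [hbar]
    have : 0 ≤ Real.cos ((q - Real.pi / 2) / 2) := by linarith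
    positivity
  have hbarend : ∀ t, Real.cosh ((t - m) / 2) = D → ∀ q ∈ Set.Icc 0 Real.pi, K ≤ bar t q := by
    intro t ht q hq
    have h1 := hcos q hq
    have h3 : 0 ≤ q * (Real.pi - q) := mul_nonneg hq.1 (by linarith [hq.2])
    have h4 : κ * (Real.cos ((q - Real.pi / 2) / 2) * D) =
        2 * K * Real.cos ((q - Real.pi / 2) / 2) := by rw [hκ]; field_simp
    simp only [hbar]
    rw [ht, h4]
    have : 0 ≤ 3 / 2 * η * (q * (Real.pi - q) / 2) := by positivity
    nlinarith
  set z : ℝ → ℝ → ℝ := fun t q => v t q - bar t q with hz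
  have hzc : ContinuousOn (Function.uncurry z) (Set.Icc a b ×ˢ Set.Icc 0 Real.pi) := by
    have : Continuous (Function.uncurry bar) := by
      simp only [hbar, Function.uncurry_def]; fun_prop
    exact hc.sub this.continuousOn
  obtain ⟨⟨t₁, q₁⟩, ⟨ht₁, hq₁⟩, hmax⟩ := (isCompact_Icc.prod isCompact_Icc).exists_isMaxOn
    (⟨(t, q), htm, hqm⟩ : (Set.Icc a b ×ˢ Set.Icc 0 Real.pi).Nonempty) hzc
  have hzmax : z t₁ q₁ ≤ 0 := by
    simp only at ht₁ hq₁
    by_contra! hzpos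
    have hta : t₁ ≠ a := by
      rintro rfl
      have := hbarend t₁ (by rw [hD, hm, ← Real.cosh_neg]; congr 1; ring) q₁ hq₁
      have := ha q₁ hq₁
      simp only [hz] at hzpos; linarith
    have htb : t₁ ≠ b := by
      rintro rfl
      have := hbarend t₁ (by rw [hD, hm]; congr 1; ring) q₁ hq₁
      have := hb q₁ hq₁
      simp only [hz] at hzpos; linarith
    have hq0 : q₁ ≠ 0 := by
      rintro rfl
      have := hbar0 t₁ 0 hq₁
      have := h0 t₁ ht₁
      simp only [hz] at hzpos; linarith
    have hqpi : q₁ ≠ Real.pi := by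
      intro h
      have h1 := hbar0 t₁ q₁ hq₁
      have := hpi t₁ ht₁
      simp only [hz] at hzpos; rw [h] at hzpos h1; linarith
    have ht₂ : t₁ ∈ Set.Ioo a b := ⟨lt_of_le_of_ne ht₁.1 hta.symm, lt_of_le_of_ne ht₁.2 htb⟩
    have hq₂ : q₁ ∈ Set.Ioo 0 Real.pi :=
      ⟨lt_of_le_of_ne hq₁.1 hq0.symm, lt_of_le_of_ne hq₁.2 hqpi⟩
    have hmt : IsLocalMax (fun s => z s q₁) t₁ := by
      filter_upwards [Ioo_mem_nhds ht₂.1 ht₂.2] with s hs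
      exact hmax (Set.mk_mem_prod ⟨hs.1.le, hs.2.le⟩ hq₁)
    have hmq : IsLocalMax (fun s => z t₁ s) q₁ := by
      filter_upwards [Ioo_mem_nhds hq₂.1 hq₂.2] with s hs
      exact hmax (Set.mk_mem_prod ht₁ ⟨hs.1.le, hs.2.le⟩)
    set c := Real.cos ((q₁ - Real.pi / 2) / 2)
    set ch := Real.cosh ((t₁ - m) / 2)
    have hlin : ∀ s : ℝ, HasDerivAt (fun s => (s - m) / 2) (1 / 2) s := fun s =>
      ((hasDerivAt_id s).sub_const m).div_const 2
    have hlin' : ∀ s : ℝ, HasDerivAt (fun s => (s - Real.pi / 2) / 2) (1 / 2) s := fun s =>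
      ((hasDerivAt_id s).sub_const _).div_const 2
    have e1 : vtt t₁ q₁ - κ * (c * (ch * (1 / 2) * (1 / 2))) ≤ 0 := by
      refine second_deriv_nonpos_of_isLocalMax hmt
        (f' := fun s => vt s q₁ - κ * (c * (Real.sinh ((s - m) / 2) * (1 / 2)))) ?_ ?_
      · filter_upwards [Ioo_mem_nhds ht₂.1 ht₂.2] with s hs
        have := ((((Real.hasDerivAt_cosh _).comp s (hlin s)).const_mul c).const_mul κ).add_const
          ((3 / 2 * η) * (q₁ * (Real.pi - q₁) / 2))
        exact (ht s hs q₁ hq₂).sub this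
      · have := (((((Real.hasDerivAt_sinh _).comp t₁ (hlin t₁)).mul_const (1 / 2)).const_mul
          c).const_mul κ)
        exact (htt t₁ ht₂ q₁ hq₂).sub this
    have e2 : vqq t₁ q₁ - (κ * (-(c * (1 / 2) * (1 / 2)) * ch) + (3 / 2 * η) * (-2 / 2)) ≤ 0 := by
      refine second_deriv_nonpos_of_isLocalMax hmq
        (f' := fun s => vq t₁ s - (κ * (-Real.sin ((s - Real.pi / 2) / 2) * (1 / 2) * ch) +
          (3 / 2 * η) * ((Real.pi - 2 * s) / 2))) ?_ ?_
      · filter_upwards [Ioo_mem_nhds hq₂.1 hq₂.2] with s hs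
        have h1 := (((Real.hasDerivAt_cos _).comp s (hlin' s)).mul_const ch).const_mul κ
        have h2 : HasDerivAt (fun s : ℝ => s * (Real.pi - s) / 2) ((Real.pi - 2 * s) / 2) s := by
          have := ((hasDerivAt_id s).mul ((hasDerivAt_id s).const_sub Real.pi)).div_const 2
          refine this.congr_deriv ?_
          simp only [id]; ring
        exact (hq t₁ ht₂ s hs).sub (h1.add (h2.const_mul _))
      · have h1 := ((((((Real.hasDerivAt_sin _).comp q₁ (hlin' q₁)).neg).mul_const
          (1 / 2)).mul_const ch).const_mul κ)
        have h2 : HasDerivAt (fun s : ℝ => (Real.pi - 2 * s) / 2) (-2 / 2) q₁ := by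
          have := (((hasDerivAt_id q₁).const_mul 2).const_sub Real.pi).div_const 2
          simpa using this
        refine ((hqq t₁ ht₂ q₁ hq₂).sub (h1.add (h2.const_mul (3 / 2 * η)))).congr_deriv ?_
        ring
    have := hlap t₁ ht₂ q₁ hq₂
    linarith
  have hfin : z t q ≤ 0 := (hmax (Set.mk_mem_prod htm hqm)).trans hzmax
  have hle : bar t q ≤ 2 * K * Real.cosh ((t - m) / 2) / D + 2 * η := by
    have h1 : Real.cos ((q - Real.pi / 2) / 2) * Real.cosh ((t - m) / 2) ≤
        Real.cosh ((t - m) / 2) :=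
      mul_le_of_le_one_left (Real.cosh_pos _).le (Real.cos_le_one _)
    have h2 := mul_le_mul_of_nonneg_left h1 hκ0
    have h3 : κ * Real.cosh ((t - m) / 2) = 2 * K * Real.cosh ((t - m) / 2) / D := by
      rw [hκ]; ring
    have h4 : q * (Real.pi - q) / 2 ≤ 4 / 3 := by
      have := Real.pi_lt_d2
      nlinarith [sq_nonneg (q - Real.pi / 2)]
    have h5 := mul_le_mul_of_nonneg_left h4 (by positivity : 0 ≤ 3 / 2 * η)
    simp only [hbar]
    linarith
  simp only [hz] at hfin
  linarith

/-- A nonnegative function bounded by `ε` on an interval of length two has a point where its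
second derivative is at most `4ε`. -/
lemma exists_second_deriv_le {g g' g'' : ℝ → ℝ} {a ε : ℝ} (hε : 0 < ε)
    (hg : ∀ t ∈ Set.Icc a (a + 2), HasDerivAt g (g' t) t)
    (hg' : ∀ t ∈ Set.Icc a (a + 2), HasDerivAt g' (g'' t) t)
    (hnn : ∀ t ∈ Set.Icc a (a + 2), 0 ≤ g t) (hle : ∀ t ∈ Set.Icc a (a + 2), g t ≤ ε) :
    ∃ t ∈ Set.Icc a (a + 2), g'' t ≤ 4 * ε := by
  by_contra! H
  have hconv : ConvexOn ℝ (Set.Icc a (a + 2)) (fun t => g t - 2 * ε * t ^ 2) := by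
    have hd : ∀ t ∈ Set.Icc a (a + 2),
        HasDerivAt (fun t => g t - 2 * ε * t ^ 2) (g' t - 2 * ε * (2 * t)) t := fun t ht => by
      have := (hg t ht).sub ((hasDerivAt_pow 2 t).const_mul (2 * ε))
      exact this.congr_deriv (by simp)
    refine convexOn_of_hasDerivWithinAt2_nonneg (f' := fun t => g' t - 2 * ε * (2 * t))
      (f'' := fun t => g'' t - 2 * ε * 2) (convex_Icc _ _)
      (fun t ht => (hd t ht).continuousAt.continuousWithinAt) ?_ ?_ ?_
    · intro t ht
      exact (hd t (interior_subset ht)).hasDerivWithinAt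
    · intro t ht
      have := (hg' t (interior_subset ht)).sub (((hasDerivAt_id t).const_mul 2).const_mul (2 * ε))
      refine (this.congr_deriv ?_).hasDerivWithinAt
      ring
    · intro t ht
      have := H t (interior_subset ht)
      linarith
  have ha : a ∈ Set.Icc a (a + 2) := ⟨le_rfl, by linarith⟩
  have hb : a + 2 ∈ Set.Icc a (a + 2) := ⟨by linarith, le_rfl⟩
  have hm : a + 1 ∈ Set.Icc a (a + 2) := ⟨by linarith, by linarith⟩
  have h1 := hconv.2 ha hb (by norm_num : (0:ℝ) ≤ 1 / 2) (by norm_num : (0:ℝ) ≤ 1 / 2)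
    (by norm_num)
  simp only [smul_eq_mul] at h1
  rw [show 1 / 2 * a + 1 / 2 * (a + 2) = a + 1 by ring] at h1
  have h2 := hnn _ hm
  have h3 := hle _ ha
  have h4 := hle _ hb
  nlinarith

/-- A function with nonpositive derivative on a left half-line lies below its limit at `-∞`. -/
lemma le_of_tendsto_atBot_of_deriv_nonpos {f f' : ℝ → ℝ} {T₀ l : ℝ}
    (hd : ∀ t < T₀, HasDerivAt f (f' t) t) (hf' : ∀ t < T₀, f' t ≤ 0)
    (hl : Tendsto f atBot (nhds l)) {t : ℝ} (ht : t < T₀) : f t ≤ l := by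
  have hanti : AntitoneOn f (Set.Iio T₀) := by
    refine antitoneOn_of_hasDerivWithinAt_nonpos (f' := f') (convex_Iio _)
      (fun s hs => (hd s hs).continuousAt.continuousWithinAt) ?_ ?_
    · intro s hs
      exact (hd s (interior_subset (s := Set.Iio T₀) hs)).hasDerivWithinAt
    · intro s hs
      exact hf' s (interior_subset (s := Set.Iio T₀) hs)
  refine ge_of_tendsto hl ?_
  filter_upwards [Iic_mem_atBot t] with s hs
  exact hanti (lt_of_le_of_lt hs ht) ht hs

/-- A solution of the Liouville system in logarithmic polar coordinates `(t, q)`, on the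
half-cylinder `t ≤ T₀`, with its partial derivatives and quantitative bounds. -/
structure CylinderSolution {n : ℕ} (A : Matrix (Fin n) (Fin n) ℝ) (μ T₀ c₁ c₂ c₃ C : ℝ) where
  U : Fin n → ℝ → ℝ → ℝ
  Ut : Fin n → ℝ → ℝ → ℝ
  Uq : Fin n → ℝ → ℝ → ℝ
  Utt : Fin n → ℝ → ℝ → ℝ
  Utq : Fin n → ℝ → ℝ → ℝ
  Uqq : Fin n → ℝ → ℝ → ℝ
  h : Fin n → ℝ → ℝ → ℝ
  ht : Fin n → ℝ → ℝ → ℝ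
  u₀ : Fin n → ℝ
  dU_t : ∀ i, ∀ t < T₀, ∀ q, HasDerivAt (fun s => U i s q) (Ut i t q) t
  dU_q : ∀ i, ∀ t < T₀, ∀ q, HasDerivAt (fun s => U i t s) (Uq i t q) q
  dUt_t : ∀ i, ∀ t < T₀, ∀ q, HasDerivAt (fun s => Ut i s q) (Utt i t q) t
  dUt_q : ∀ i, ∀ t < T₀, ∀ q, HasDerivAt (fun s => Ut i t s) (Utq i t q) q
  dUq_t : ∀ i, ∀ t < T₀, ∀ q, HasDerivAt (fun s => Uq i s q) (Utq i t q) t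
  dUq_q : ∀ i, ∀ t < T₀, ∀ q, HasDerivAt (fun s => Uq i t s) (Uqq i t q) q
  dh_t : ∀ i, ∀ t < T₀, ∀ q, HasDerivAt (fun s => h i s q) (ht i t q) t
  cont_U : ∀ i, ContinuousOn (Function.uncurry (U i)) (Set.Iic T₀ ×ˢ Set.univ)
  cont_Ut : ∀ i, ContinuousOn (Function.uncurry (Ut i)) (Set.Iio T₀ ×ˢ Set.univ)
  cont_Uq : ∀ i, ContinuousOn (Function.uncurry (Uq i)) (Set.Iio T₀ ×ˢ Set.univ)
  cont_Utt : ∀ i, ContinuousOn (Function.uncurry (Utt i)) (Set.Iio T₀ ×ˢ Set.univ)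
  cont_Utq : ∀ i, ContinuousOn (Function.uncurry (Utq i)) (Set.Iio T₀ ×ˢ Set.univ)
  cont_Uqq : ∀ i, ContinuousOn (Function.uncurry (Uqq i)) (Set.Iio T₀ ×ˢ Set.univ)
  cont_h : ∀ i, ContinuousOn (Function.uncurry (h i)) (Set.Iio T₀ ×ˢ Set.univ)
  cont_ht : ∀ i, ContinuousOn (Function.uncurry (ht i)) (Set.Iio T₀ ×ˢ Set.univ)
  per_U : ∀ i t, Function.Periodic (U i t) (2 * Real.pi)
  per_Ut : ∀ i t, Function.Periodic (Ut i t) (2 * Real.pi)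
  per_Uq : ∀ i t, Function.Periodic (Uq i t) (2 * Real.pi)
  pde : ∀ i, ∀ t < T₀, ∀ q,
    Utt i t q + Uqq i t q = -∑ j, A i j * (h j t q * Real.exp (U j t q))
  h_lb : ∀ i, ∀ t < T₀, ∀ q, c₁ ≤ h i t q
  h_ub : ∀ i, ∀ t < T₀, ∀ q, h i t q ≤ c₂
  ht_le : ∀ i, ∀ t < T₀, ∀ q, |ht i t q| ≤ c₃ * Real.exp t
  U_le : ∀ i, ∀ t ≤ T₀, ∀ q, U i t q ≤ C
  osc : ∀ i q q', |U i T₀ q - U i T₀ q'| ≤ C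
  lim : ∀ i, ∀ ε > 0, ∃ T, ∀ t ≤ T, ∀ q, |U i t q - 2 * μ * t - u₀ i| ≤ ε

lemma continuous_slice {T₀ : ℝ} {f : ℝ → ℝ → ℝ}
    (hf : ContinuousOn (Function.uncurry f) (Set.Iio T₀ ×ˢ Set.univ)) {t : ℝ} (ht : t < T₀) :
    Continuous (f t) := by
  have : ContinuousOn (fun q : ℝ => Function.uncurry f (t, q)) Set.univ :=
    hf.comp (by fun_prop) (fun q _ => ⟨ht, trivial⟩)
  exact continuousOn_univ.mp this

/-- The average of a function over a period. -/
def circleMean (f : ℝ → ℝ) : ℝ := (2 * Real.pi)⁻¹ * ∫ q in (0:ℝ)..(2 * Real.pi), f q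

lemma integral_eq_circleMean (f : ℝ → ℝ) :
    ∫ q in (0:ℝ)..(2 * Real.pi), f q = 2 * Real.pi * circleMean f := by
  have := Real.pi_pos
  rw [circleMean]; field_simp

lemma circleMean_const (c : ℝ) : circleMean (fun _ => c) = c := by
  have := Real.pi_pos
  simp only [circleMean, intervalIntegral.integral_const, smul_eq_mul]; field_simp; ring

lemma circleMean_add {f g : ℝ → ℝ} (hf : Continuous f) (hg : Continuous g) :
    circleMean (fun q => f q + g q) = circleMean f + circleMean g := by
  rw [circleMean, intervalIntegral.integral_add (hf.intervalIntegrable _ _)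
    (hg.intervalIntegrable _ _), circleMean, circleMean]; ring

lemma circleMean_sub {f g : ℝ → ℝ} (hf : Continuous f) (hg : Continuous g) :
    circleMean (fun q => f q - g q) = circleMean f - circleMean g := by
  rw [circleMean, intervalIntegral.integral_sub (hf.intervalIntegrable _ _)
    (hg.intervalIntegrable _ _), circleMean, circleMean]; ring

lemma circleMean_const_mul (c : ℝ) (f : ℝ → ℝ) :
    circleMean (fun q => c * f q) = c * circleMean f := by
  rw [circleMean, intervalIntegral.integral_const_mul, circleMean]; ring

lemma circleMean_neg (f : ℝ → ℝ) : circleMean (fun q => -f q) = -circleMean f := by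
  rw [circleMean, intervalIntegral.integral_neg, circleMean]; ring

lemma circleMean_sum {ι : Type*} (s : Finset ι) {f : ι → ℝ → ℝ} (hf : ∀ i ∈ s, Continuous (f i)) :
    circleMean (fun q => ∑ i ∈ s, f i q) = ∑ i ∈ s, circleMean (f i) := by
  rw [circleMean, intervalIntegral.integral_finsetSum
    (fun i hi => (hf i hi).intervalIntegrable _ _), Finset.mul_sum]
  rfl

lemma circleMean_mono {f g : ℝ → ℝ} (hf : Continuous f) (hg : Continuous g)
    (hfg : ∀ q, f q ≤ g q) : circleMean f ≤ circleMean g := by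
  have := Real.pi_pos
  exact mul_le_mul_of_nonneg_left (intervalIntegral.integral_mono (by positivity)
    (hf.intervalIntegrable _ _) (hg.intervalIntegrable _ _) hfg) (by positivity)

lemma circleMean_le {f : ℝ → ℝ} (hf : Continuous f) {c : ℝ} (h : ∀ q, f q ≤ c) :
    circleMean f ≤ c := by
  simpa [circleMean_const] using circleMean_mono hf continuous_const h

lemma le_circleMean {f : ℝ → ℝ} (hf : Continuous f) {c : ℝ} (h : ∀ q, c ≤ f q) :
    c ≤ circleMean f := by
  simpa [circleMean_const] using circleMean_mono continuous_const hf h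

lemma abs_circleMean_le {f g : ℝ → ℝ} (hf : Continuous f) (hg : Continuous g)
    (h : ∀ q, |f q| ≤ g q) : |circleMean f| ≤ circleMean g := by
  rw [abs_le, ← circleMean_neg]
  exact ⟨circleMean_mono hg.neg hf fun q => neg_le_of_abs_le (h q),
    circleMean_mono hf hg fun q => le_of_abs_le (h q)⟩

/-- The derivative of a periodic function has mean zero. -/
lemma circleMean_deriv_eq_zero {f f' : ℝ → ℝ} (hf : ∀ q, HasDerivAt f (f' q) q)
    (hf' : Continuous f') (hp : Function.Periodic f (2 * Real.pi)) : circleMean f' = 0 := by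
  rw [circleMean, intervalIntegral.integral_eq_sub_of_hasDerivAt (fun q _ => hf q)
    (hf'.intervalIntegrable _ _)]
  have := hp 0
  simp only [zero_add] at this
  rw [this]; simp

lemma hasDerivAt_circleMean {T₀ : ℝ} {f f' : ℝ → ℝ → ℝ}
    (hf : ∀ t < T₀, Continuous (f t))
    (hd : ∀ t < T₀, ∀ q, HasDerivAt (fun s => f s q) (f' t q) t)
    (hc : ContinuousOn (Function.uncurry f') (Set.Iio T₀ ×ˢ Set.univ)) {t : ℝ} (ht : t < T₀) :
    HasDerivAt (fun s => circleMean (f s)) (circleMean (f' t)) t :=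
  (hasDerivAt_integral_period hf hd hc ht).const_mul _

namespace CylinderSolution

variable {n : ℕ} {A : Matrix (Fin n) (Fin n) ℝ} {μ T₀ c₁ c₂ c₃ C : ℝ}
  (D : CylinderSolution A μ T₀ c₁ c₂ c₃ C)

/-- The nonlinearity. -/
def F (j : Fin n) (t q : ℝ) : ℝ := D.h j t q * Real.exp (D.U j t q)

/-- The angular average of `U`. -/
def φ (i : Fin n) (t : ℝ) : ℝ := circleMean (D.U i t)

/-- The angular average of `∂ₜ U`. -/
def φt (i : Fin n) (t : ℝ) : ℝ := circleMean (D.Ut i t)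

/-- The angular average of the nonlinearity. -/
def Fm (i : Fin n) (t : ℝ) : ℝ := circleMean (D.F i t)

/-- The local energy. -/
def σ (i : Fin n) (t : ℝ) : ℝ := ∑ j, A⁻¹ i j * (2 * μ - D.φt j t)

lemma cont_U' (i : Fin n) : ContinuousOn (Function.uncurry (D.U i)) (Set.Iio T₀ ×ˢ Set.univ) :=
  (D.cont_U i).mono (Set.prod_mono Set.Iio_subset_Iic_self le_rfl)

lemma continuous_U (i : Fin n) {t : ℝ} (ht : t ≤ T₀) : Continuous (D.U i t) := by
  have : ContinuousOn (fun q : ℝ => Function.uncurry (D.U i) (t, q)) Set.univ :=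
    (D.cont_U i).comp (by fun_prop) (fun q _ => ⟨ht, trivial⟩)
  exact continuousOn_univ.mp this

lemma continuous_Ut (i : Fin n) {t : ℝ} (ht : t < T₀) : Continuous (D.Ut i t) :=
  continuous_slice (D.cont_Ut i) ht

lemma continuous_Uq (i : Fin n) {t : ℝ} (ht : t < T₀) : Continuous (D.Uq i t) :=
  continuous_slice (D.cont_Uq i) ht

lemma continuous_Uqq (i : Fin n) {t : ℝ} (ht : t < T₀) : Continuous (D.Uqq i t) :=
  continuous_slice (D.cont_Uqq i) ht

lemma continuous_Utq (i : Fin n) {t : ℝ} (ht : t < T₀) : Continuous (D.Utq i t) :=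
  continuous_slice (D.cont_Utq i) ht

lemma continuous_Utt (i : Fin n) {t : ℝ} (ht : t < T₀) : Continuous (D.Utt i t) :=
  continuous_slice (D.cont_Utt i) ht

lemma cont_F (i : Fin n) : ContinuousOn (Function.uncurry (D.F i)) (Set.Iio T₀ ×ˢ Set.univ) :=
  (D.cont_h i).mul (D.cont_U' i).rexp

lemma continuous_F (i : Fin n) {t : ℝ} (ht : t < T₀) : Continuous (D.F i t) :=
  continuous_slice (D.cont_F i) ht

lemma F_nonneg (hc₁ : 0 < c₁) (i : Fin n) {t : ℝ} (ht : t < T₀) (q : ℝ) : 0 ≤ D.F i t q :=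
  mul_nonneg (hc₁.le.trans (D.h_lb i t ht q)) (Real.exp_pos _).le

lemma F_le (i : Fin n) {t : ℝ} (ht : t < T₀) (q : ℝ) :
    D.F i t q ≤ c₂ * Real.exp (D.U i t q) :=
  mul_le_mul_of_nonneg_right (D.h_ub i t ht q) (Real.exp_pos _).le

lemma c₂_pos (D : CylinderSolution A μ T₀ c₁ c₂ c₃ C) (hc₁ : 0 < c₁) (i : Fin n) : 0 < c₂ :=
  hc₁.trans_le ((D.h_lb i (T₀ - 1) (by linarith) 0).trans (D.h_ub i (T₀ - 1) (by linarith) 0))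

lemma Fm_nonneg (hc₁ : 0 < c₁) (i : Fin n) {t : ℝ} (ht : t < T₀) : 0 ≤ D.Fm i t :=
  le_circleMean (D.continuous_F i ht) (D.F_nonneg hc₁ i ht)

lemma hasDerivAt_φ (i : Fin n) {t : ℝ} (ht : t < T₀) :
    HasDerivAt (D.φ i) (D.φt i t) t :=
  hasDerivAt_circleMean (fun _ hs => D.continuous_U i hs.le) (D.dU_t i) (D.cont_Ut i) ht

lemma circleMean_Uqq (i : Fin n) {t : ℝ} (ht : t < T₀) : circleMean (D.Uqq i t) = 0 :=
  circleMean_deriv_eq_zero (D.dUq_q i t ht) (D.continuous_Uqq i ht) (D.per_Uq i t)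

lemma Utt_eq (i : Fin n) {t : ℝ} (ht : t < T₀) (q : ℝ) :
    D.Utt i t q = -(∑ j, A i j * D.F j t q) - D.Uqq i t q := by
  have := D.pde i t ht q
  simp only [F]; linarith

lemma continuous_sum_F (i : Fin n) {t : ℝ} (ht : t < T₀) :
    Continuous fun q => ∑ j, A i j * D.F j t q :=
  continuous_finsetSum _ fun j _ => (D.continuous_F j ht).const_mul _

lemma circleMean_sum_F (i : Fin n) {t : ℝ} (ht : t < T₀) :
    circleMean (fun q => ∑ j, A i j * D.F j t q) = ∑ j, A i j * D.Fm j t := by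
  rw [circleMean_sum _ fun j _ => (D.continuous_F j ht).const_mul _]
  simp only [circleMean_const_mul, Fm]

lemma hasDerivAt_φt (i : Fin n) {t : ℝ} (ht : t < T₀) :
    HasDerivAt (D.φt i) (-∑ j, A i j * D.Fm j t) t := by
  have h := hasDerivAt_circleMean (fun _ hs => D.continuous_Ut i hs) (D.dUt_t i) (D.cont_Utt i) ht
  refine h.congr_deriv ?_
  have : D.Utt i t = fun q => -(∑ j, A i j * D.F j t q) - D.Uqq i t q :=
    funext fun q => D.Utt_eq i ht q
  have hneg : Continuous fun q => -∑ j, A i j * D.F j t q := (D.continuous_sum_F i ht).neg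
  rw [this, circleMean_sub hneg (D.continuous_Uqq i ht),
    circleMean_neg, D.circleMean_sum_F i ht, D.circleMean_Uqq i ht, sub_zero]

lemma hasDerivAt_σ (hA : IsUnit A.det) (i : Fin n) {t : ℝ} (ht : t < T₀) :
    HasDerivAt (D.σ i) (D.Fm i t) t := by
  have h : HasDerivAt (D.σ i) (∑ j, A⁻¹ i j * (∑ l, A j l * D.Fm l t)) t := by
    unfold σ
    refine HasDerivAt.fun_sum fun j _ => ?_
    have := ((D.hasDerivAt_φt j ht).const_sub (2 * μ)).const_mul (A⁻¹ i j)
    simpa using this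
  refine h.congr_deriv ?_
  have h1 : (A⁻¹).mulVec (A.mulVec (fun l => D.Fm l t)) = fun l => D.Fm l t := by
    rw [Matrix.mulVec_mulVec, Matrix.nonsing_inv_mul _ hA, Matrix.one_mulVec]
  have := congrFun h1 i
  simpa [Matrix.mulVec, dotProduct] using this

lemma sum_mul_σ (hA : IsUnit A.det) (i : Fin n) (t : ℝ) :
    ∑ j, A i j * D.σ j t = 2 * μ - D.φt i t := by
  have h1 : A.mulVec (A⁻¹.mulVec (fun l => 2 * μ - D.φt l t)) = fun l => 2 * μ - D.φt l t := by
    rw [Matrix.mulVec_mulVec, Matrix.mul_nonsing_inv _ hA, Matrix.one_mulVec]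
  have := congrFun h1 i
  simpa [Matrix.mulVec, dotProduct, σ] using this

lemma σ_mono (hA : IsUnit A.det) (hc₁ : 0 < c₁) (i : Fin n) :
    MonotoneOn (D.σ i) (Set.Iio T₀) := by
  refine monotoneOn_of_hasDerivWithinAt_nonneg (f' := D.Fm i) (convex_Iio _)
    (fun s hs => (D.hasDerivAt_σ hA i hs).continuousAt.continuousWithinAt) ?_ ?_
  · intro s hs
    exact (D.hasDerivAt_σ hA i (interior_subset (s := Set.Iio T₀) hs)).hasDerivWithinAt
  · intro s hs
    exact D.Fm_nonneg hc₁ i (interior_subset (s := Set.Iio T₀) hs)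

lemma φt_anti (hc₁ : 0 < c₁) (hA0 : ∀ i j, 0 ≤ A i j) (i : Fin n) :
    AntitoneOn (D.φt i) (Set.Iio T₀) := by
  refine antitoneOn_of_hasDerivWithinAt_nonpos (f' := fun t => -∑ j, A i j * D.Fm j t)
    (convex_Iio _)
    (fun s hs => (D.hasDerivAt_φt i hs).continuousAt.continuousWithinAt) ?_ ?_
  · intro s hs
    exact (D.hasDerivAt_φt i (interior_subset (s := Set.Iio T₀) hs)).hasDerivWithinAt
  · intro s hs
    exact neg_nonpos.mpr (Finset.sum_nonneg fun j _ => mul_nonneg (hA0 i j)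
      (D.Fm_nonneg hc₁ j (interior_subset (s := Set.Iio T₀) hs)))

lemma tendsto_φ_sub (i : Fin n) :
    Tendsto (fun t => D.φ i t - 2 * μ * t) atBot (nhds (D.u₀ i)) := by
  rw [Metric.tendsto_nhds]
  intro ε hε
  obtain ⟨T, hT⟩ := D.lim i (ε / 2) (by positivity)
  filter_upwards [Iic_mem_atBot T, Iic_mem_atBot T₀] with t ht ht'
  have hc := D.continuous_U i ht'
  have h1 : D.φ i t - 2 * μ * t - D.u₀ i = circleMean fun q => D.U i t q - 2 * μ * t - D.u₀ i := by
    rw [circleMean_sub (f := fun q => D.U i t q - 2 * μ * t) (by fun_prop) continuous_const,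
      circleMean_sub hc continuous_const, circleMean_const, circleMean_const, φ]
  rw [Real.dist_eq, h1]
  have h2 := abs_circleMean_le (f := fun q => D.U i t q - 2 * μ * t - D.u₀ i) (by fun_prop)
    (continuous_const (y := ε / 2)) (hT t ht)
  rw [circleMean_const] at h2
  linarith

lemma tendsto_φt (hc₁ : 0 < c₁) (hA0 : ∀ i j, 0 ≤ A i j) (i : Fin n) :
    Tendsto (D.φt i) atBot (nhds (2 * μ)) := by
  have hlim := D.tendsto_φ_sub i
  have hplus : Tendsto (fun t : ℝ => t + 1) atBot atBot :=
    tendsto_atBot_add_const_right _ _ tendsto_id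
  have hminus : Tendsto (fun t : ℝ => t - 1) atBot atBot :=
    tendsto_atBot_add_const_right _ (-1) tendsto_id
  have h1 : Tendsto (fun t => (D.φ i (t + 1) - 2 * μ * (t + 1)) - (D.φ i t - 2 * μ * t) + 2 * μ)
      atBot (nhds (2 * μ)) := by
    simpa using ((hlim.comp hplus).sub hlim).add_const (2 * μ)
  have h2 : Tendsto (fun t => (D.φ i t - 2 * μ * t) - (D.φ i (t - 1) - 2 * μ * (t - 1)) + 2 * μ)
      atBot (nhds (2 * μ)) := by
    simpa using (hlim.sub (hlim.comp hminus)).add_const (2 * μ)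
  have key : ∀ a, a + 1 < T₀ → D.φt i (a + 1) ≤ D.φ i (a + 1) - D.φ i a ∧
      D.φ i (a + 1) - D.φ i a ≤ D.φt i a := by
    intro a ha
    obtain ⟨ξ, hξ, hξ'⟩ := exists_hasDerivAt_eq_slope (D.φ i) (D.φt i) (by linarith : a < a + 1)
      (fun s hs => (D.hasDerivAt_φ i (hs.2.trans_lt ha)).continuousAt.continuousWithinAt)
      (fun s hs => D.hasDerivAt_φ i (hs.2.trans ha))
    have e : D.φ i (a + 1) - D.φ i a = D.φt i ξ := by rw [hξ']; simp
    rw [e]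
    exact ⟨D.φt_anti hc₁ hA0 i (hξ.2.trans ha) ha hξ.2.le,
      D.φt_anti hc₁ hA0 i (by simp only [Set.mem_Iio]; linarith) (hξ.2.trans ha) hξ.1.le⟩
  refine tendsto_of_tendsto_of_tendsto_of_le_of_le' h1 h2 ?_ ?_
  · filter_upwards [Iio_mem_atBot (T₀ - 1)] with t ht
    have := (key t (by simp only [Set.mem_Iio] at ht; linarith)).2
    linarith
  · filter_upwards [Iio_mem_atBot T₀] with t ht
    have := (key (t - 1) (by simpa using ht)).1
    simp only [sub_add_cancel] at this
    linarith

lemma tendsto_σ (hc₁ : 0 < c₁) (hA0 : ∀ i j, 0 ≤ A i j) (i : Fin n) :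
    Tendsto (D.σ i) atBot (nhds 0) := by
  have : Tendsto (D.σ i) atBot (nhds (∑ j, A⁻¹ i j * (2 * μ - 2 * μ))) :=
    tendsto_finsetSum _ fun j _ => ((D.tendsto_φt hc₁ hA0 j).const_sub _).const_mul _
  simpa using this

lemma σ_nonneg (hA : IsUnit A.det) (hc₁ : 0 < c₁) (hA0 : ∀ i j, 0 ≤ A i j) (i : Fin n) {t : ℝ}
    (ht : t < T₀) : 0 ≤ D.σ i t := by
  refine le_of_tendsto (D.tendsto_σ hc₁ hA0 i) ?_
  filter_upwards [Iic_mem_atBot t] with s hs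
  exact D.σ_mono hA hc₁ i (lt_of_le_of_lt hs ht) ht hs

/-- Oscillation decay on a finite cylinder. -/
lemma osc_le_of_ends (i : Fin n) {a b K η : ℝ} (hab : a < b) (hb : b ≤ T₀) (hK : 0 ≤ K)
    (hη : 0 < η) (hKa : ∀ q q', |D.U i a q - D.U i a q'| ≤ K)
    (hKb : ∀ q q', |D.U i b q - D.U i b q'| ≤ K)
    (hG : ∀ t ∈ Set.Ioo a b, ∀ q q',
      |(∑ j, A i j * D.F j t q) - (∑ j, A i j * D.F j t q')| ≤ η)
    {t : ℝ} (ht : t ∈ Set.Icc a b) (q q' : ℝ) :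
    D.U i t q - D.U i t q' ≤
      2 * K * Real.cosh ((t - (a + b) / 2) / 2) / Real.cosh ((b - a) / 4) + 2 * η := by
  have main : ∀ α β θ : ℝ, (∀ s, D.U i s (α + Real.pi) = D.U i s (α - Real.pi)) →
      θ ∈ Set.Icc 0 Real.pi → |β| = 1 → β * (D.U i t (α + θ) - D.U i t (α - θ)) ≤
      2 * K * Real.cosh ((t - (a + b) / 2) / 2) / Real.cosh ((b - a) / 4) + 2 * η := by
    intro α β θ hα hθ hβ
    have habs : ∀ x c : ℝ, |x| ≤ c → β * x ≤ c := fun x c hx =>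
      (le_abs_self _).trans (by rwa [abs_mul, hβ, one_mul])
    have hlt : ∀ s ∈ Set.Ioo a b, s < T₀ := fun s hs => hs.2.trans_le hb
    have hadd : ∀ s : ℝ, HasDerivAt (fun q : ℝ => α + q) 1 s := fun s =>
      (hasDerivAt_id s).const_add α
    have hsub : ∀ s : ℝ, HasDerivAt (fun q : ℝ => α - q) (-1) s := fun s =>
      (hasDerivAt_id s).const_sub α
    refine rectangle_max_principle hab hK hη
      (v := fun s q => β * (D.U i s (α + q) - D.U i s (α - q)))
      (vt := fun s q => β * (D.Ut i s (α + q) - D.Ut i s (α - q)))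
      (vtt := fun s q => β * (D.Utt i s (α + q) - D.Utt i s (α - q)))
      (vq := fun s q => β * (D.Uq i s (α + q) * 1 - D.Uq i s (α - q) * (-1)))
      (vqq := fun s q => β * (D.Uqq i s (α + q) * 1 * 1 - D.Uqq i s (α - q) * (-1) * (-1)))
      ?_ ?_ ?_ ?_ ?_ ?_ ?_ ?_ ?_ ?_ ht hθ
    · have h1 : ContinuousOn (fun p : ℝ × ℝ => D.U i p.1 (α + p.2))
          (Set.Icc a b ×ˢ Set.Icc 0 Real.pi) :=
        (D.cont_U i).comp (f := fun p : ℝ × ℝ => (p.1, α + p.2)) (by fun_prop)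
          (fun p hp => ⟨hp.1.2.trans hb, trivial⟩)
      have h2 : ContinuousOn (fun p : ℝ × ℝ => D.U i p.1 (α - p.2))
          (Set.Icc a b ×ˢ Set.Icc 0 Real.pi) :=
        (D.cont_U i).comp (f := fun p : ℝ × ℝ => (p.1, α - p.2)) (by fun_prop)
          (fun p hp => ⟨hp.1.2.trans hb, trivial⟩)
      exact (h1.sub h2).const_mul β
    · intro s hs q _
      exact ((D.dU_t i s (hlt s hs) _).sub (D.dU_t i s (hlt s hs) _)).const_mul β
    · intro s hs q _
      exact ((D.dUt_t i s (hlt s hs) _).sub (D.dUt_t i s (hlt s hs) _)).const_mul β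
    · intro s hs q _
      exact (((D.dU_q i s (hlt s hs) _).comp q (hadd q)).sub
        ((D.dU_q i s (hlt s hs) _).comp q (hsub q))).const_mul β
    · intro s hs q _
      exact ((((D.dUq_q i s (hlt s hs) _).comp q (hadd q)).mul_const 1).sub
        (((D.dUq_q i s (hlt s hs) _).comp q (hsub q)).mul_const (-1))).const_mul β
    · intro s hs q _
      have h1 := D.Utt_eq i (hlt s hs) (α + q)
      have h2 := D.Utt_eq i (hlt s hs) (α - q)
      have h3 := habs _ _ (hG s hs (α + q) (α - q))
      rw [h1, h2]
      linarith
    · intro s _; simp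
    · intro s _; simp [hα s]
    · intro q _; exact habs _ _ (hKa _ _)
    · intro q _; exact habs _ _ (hKb _ _)
  obtain ⟨x, hx, hxe⟩ := (D.per_U i t).exists_mem_Ico₀ (by positivity) q
  obtain ⟨y, hy, hye⟩ := (D.per_U i t).exists_mem_Ico₀ (by positivity) q'
  have hper : ∀ s, D.U i s ((x + y) / 2 + Real.pi) = D.U i s ((x + y) / 2 - Real.pi) := by
    intro s
    rw [← D.per_U i s ((x + y) / 2 - Real.pi)]
    congr 1; ring
  rw [hxe, hye]
  rcases le_total y x with hxy | hxy
  · have := main ((x + y) / 2) 1 ((x - y) / 2) hper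
      ⟨by linarith, by linarith [hx.2, hy.1]⟩ (by simp)
    rw [show (x + y) / 2 + (x - y) / 2 = x by ring, show (x + y) / 2 - (x - y) / 2 = y by ring]
      at this
    linarith
  · have := main ((x + y) / 2) (-1) ((y - x) / 2) hper
      ⟨by linarith, by linarith [hy.2, hx.1]⟩ (by simp)
    rw [show (x + y) / 2 + (y - x) / 2 = y by ring, show (x + y) / 2 - (y - x) / 2 = x by ring]
      at this
    linarith

end CylinderSolution

/-- A uniform bound for the angular oscillation of cylinder solutions. -/
def oscBound {n : ℕ} (A : Matrix (Fin n) (Fin n) ℝ) (c₂ C : ℝ) : ℝ :=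
  2 * (|C| + 1) + 2 * ((∑ i, ∑ j, A i j) * (c₂ * Real.exp C) + 1)

namespace CylinderSolution

variable {n : ℕ} {A : Matrix (Fin n) (Fin n) ℝ} {μ T₀ c₁ c₂ c₃ C : ℝ}
  (D : CylinderSolution A μ T₀ c₁ c₂ c₃ C)

lemma sum_F_bounds (hc₁ : 0 < c₁) (hA0 : ∀ i j, 0 ≤ A i j) (i : Fin n) {t η : ℝ} (ht : t < T₀)
    (hη : 0 ≤ η) (hF : ∀ j q, D.F j t q ≤ η) (q : ℝ) :
    0 ≤ ∑ j, A i j * D.F j t q ∧ ∑ j, A i j * D.F j t q ≤ (∑ i, ∑ j, A i j) * η := by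
  refine ⟨Finset.sum_nonneg fun j _ => mul_nonneg (hA0 i j) (D.F_nonneg hc₁ j ht q), ?_⟩
  calc ∑ j, A i j * D.F j t q ≤ ∑ j, A i j * η :=
        Finset.sum_le_sum fun j _ => mul_le_mul_of_nonneg_left (hF j q) (hA0 i j)
    _ = (∑ j, A i j) * η := by rw [Finset.sum_mul]
    _ ≤ _ := mul_le_mul_of_nonneg_right (Finset.single_le_sum (f := fun i => ∑ j, A i j)
        (fun i _ => Finset.sum_nonneg fun j _ => hA0 i j) (Finset.mem_univ i)) hη

lemma F_le_const (hc₁ : 0 < c₁) (i : Fin n) {t : ℝ} (ht : t < T₀) (q : ℝ) :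
    D.F i t q ≤ c₂ * Real.exp C :=
  (D.F_le i ht q).trans (mul_le_mul_of_nonneg_left (Real.exp_le_exp.mpr (D.U_le i t ht.le q))
    (D.c₂_pos hc₁ i).le)

lemma sum_sum_nonneg (hA0 : ∀ i j, 0 ≤ A i j) : 0 ≤ ∑ i, ∑ j, A i j :=
  Finset.sum_nonneg fun i _ => Finset.sum_nonneg fun j _ => hA0 i j

lemma oscBound_pos (D : CylinderSolution A μ T₀ c₁ c₂ c₃ C) (hc₁ : 0 < c₁)
    (hA0 : ∀ i j, 0 ≤ A i j) (i : Fin n) : 0 < oscBound A c₂ C := by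
  have := D.c₂_pos hc₁ i
  have := sum_sum_nonneg hA0
  unfold oscBound
  positivity

lemma cosh_div_le_one {a b t : ℝ} (ht : t ∈ Set.Icc a b) :
    Real.cosh ((t - (a + b) / 2) / 2) / Real.cosh ((b - a) / 4) ≤ 1 := by
  rw [div_le_one (Real.cosh_pos _), Real.cosh_le_cosh, abs_le]
  have h : 0 ≤ (b - a) / 4 := by linarith [ht.1, ht.2]
  rw [abs_of_nonneg h]
  constructor <;> linarith [ht.1, ht.2]

lemma osc_le (hc₁ : 0 < c₁) (hA0 : ∀ i j, 0 ≤ A i j) (i : Fin n) {t : ℝ} (ht : t ≤ T₀)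
    (q q' : ℝ) : |D.U i t q - D.U i t q'| ≤ oscBound A c₂ C := by
  obtain ⟨T, hT⟩ := D.lim i (1 / 2) (by norm_num)
  have hc₂ := D.c₂_pos hc₁ i
  have hs := sum_sum_nonneg hA0
  set a := min T t - 1 with ha
  have haT : a ≤ T := by linarith [min_le_left T t]
  have hat : a < t := by linarith [min_le_right T t]
  have key : ∀ q q', D.U i t q - D.U i t q' ≤ oscBound A c₂ C := by
    intro q q'
    have h1 := D.osc_le_of_ends i (a := a) (b := T₀) (K := |C| + 1)
      (η := (∑ i, ∑ j, A i j) * (c₂ * Real.exp C) + 1) (hat.trans_le ht) le_rfl (by positivity)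
      (by positivity) ?_ ?_ ?_ ⟨hat.le, ht⟩ q q'
    · have h2 := cosh_div_le_one (a := a) (b := T₀) ⟨hat.le, ht⟩
      have h3 := mul_le_mul_of_nonneg_left h2 (by positivity : 0 ≤ 2 * (|C| + 1))
      rw [← mul_div_assoc] at h3
      unfold oscBound
      linarith
    · intro q q'
      have h1 := abs_le.mp (hT a haT q)
      have h2 := abs_le.mp (hT a haT q')
      have := abs_nonneg C
      rw [abs_le]; constructor <;> linarith [h1.1, h1.2, h2.1, h2.2]
    · intro q q'
      linarith [D.osc i q q', le_abs_self C]
    · intro s hs q q'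
      have hb := D.sum_F_bounds hc₁ hA0 i (η := c₂ * Real.exp C) hs.2 (by positivity)
        (fun j q => D.F_le_const hc₁ j hs.2 q)
      have h1 := hb q
      have h2 := hb q'
      rw [abs_le]; constructor <;> linarith [h1.1, h1.2, h2.1, h2.2]
  rw [abs_le]
  exact ⟨by linarith [key q' q], key q q'⟩

lemma abs_U_sub_φ_le (i : Fin n) {t κ : ℝ} (ht : t ≤ T₀)
    (hκ : ∀ q q', |D.U i t q - D.U i t q'| ≤ κ) (q : ℝ) : |D.U i t q - D.φ i t| ≤ κ := by
  have hc := D.continuous_U i ht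
  have h1 : D.φ i t ≤ D.U i t q + κ := circleMean_le hc fun q' => by
    linarith [(abs_le.mp (hκ q q')).1]
  have h2 : D.U i t q - κ ≤ D.φ i t := le_circleMean hc fun q' => by
    linarith [(abs_le.mp (hκ q q')).2]
  rw [abs_le]; constructor <;> linarith

lemma F_le_exp_φ (hc₁ : 0 < c₁) (hA0 : ∀ i j, 0 ≤ A i j) (i : Fin n) {t : ℝ} (ht : t < T₀)
    (q : ℝ) : D.F i t q ≤ c₂ * Real.exp (oscBound A c₂ C) * Real.exp (D.φ i t) := by
  have h := (abs_le.mp (D.abs_U_sub_φ_le i ht.le (D.osc_le hc₁ hA0 i ht.le) q)).2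
  rw [mul_assoc, ← Real.exp_add]
  exact (D.F_le i ht q).trans (mul_le_mul_of_nonneg_left (Real.exp_le_exp.mpr (by linarith))
    (D.c₂_pos hc₁ i).le)

lemma exp_φ_le_Fm (hc₁ : 0 < c₁) (hA0 : ∀ i j, 0 ≤ A i j) (i : Fin n) {t : ℝ} (ht : t < T₀) :
    c₁ * Real.exp (-oscBound A c₂ C) * Real.exp (D.φ i t) ≤ D.Fm i t := by
  refine le_circleMean (D.continuous_F i ht) fun q => ?_
  have h := (abs_le.mp (D.abs_U_sub_φ_le i ht.le (D.osc_le hc₁ hA0 i ht.le) q)).1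
  rw [mul_assoc, ← Real.exp_add]
  exact mul_le_mul (D.h_lb i t ht q) (Real.exp_le_exp.mpr (by linarith)) (Real.exp_pos _).le
    (hc₁.le.trans (D.h_lb i t ht q))

/-- The energy of the nonradial part of the solution on a slice. -/
def S (t : ℝ) : ℝ :=
  ∑ i, circleMean fun q => (D.Ut i t q - D.φt i t) ^ 2 + D.Uq i t q ^ 2

lemma cont_fst {f f' : ℝ → ℝ} (hf : ∀ t < T₀, HasDerivAt f (f' t) t) :
    ContinuousOn (fun p : ℝ × ℝ => f p.1) (Set.Iio T₀ ×ˢ Set.univ) := by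
  have h : ContinuousOn f (Set.Iio T₀) := fun t ht => (hf t ht).continuousAt.continuousWithinAt
  exact h.comp (by fun_prop) fun p hp => hp.1

lemma continuousOn_Fm (j : Fin n) : ContinuousOn (D.Fm j) (Set.Iio T₀) := by
  intro t ht
  refine ContinuousAt.continuousWithinAt ?_
  refine ContinuousAt.const_mul ?_ _
  set ε := (T₀ - t) / 2 with hε
  have hεpos : 0 < ε := by rw [hε]; simp only [Set.mem_Iio] at ht; linarith
  have hsub : Set.Icc (t - ε) (t + ε) ×ˢ Set.Icc 0 (2 * Real.pi) ⊆
      Set.Iio T₀ ×ˢ (Set.univ : Set ℝ) := by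
    rintro ⟨s, q⟩ ⟨⟨_, h2⟩, _⟩
    exact ⟨by simp only [Set.mem_Iio]; simp only at h2; rw [hε] at h2; linarith, trivial⟩
  obtain ⟨B, hB⟩ := (isCompact_Icc.prod isCompact_Icc).exists_bound_of_continuousOn
    ((D.cont_F j).mono hsub)
  have hnhds : Set.Ioo (t - ε) (t + ε) ∈ nhds t := Ioo_mem_nhds (by linarith) (by linarith)
  refine intervalIntegral.continuousAt_of_dominated_interval (bound := fun _ => B) ?_ ?_
    intervalIntegrable_const ?_
  · filter_upwards [Iio_mem_nhds ht] with s hs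
    exact (D.continuous_F j hs).aestronglyMeasurable
  · filter_upwards [hnhds] with s hs
    refine Eventually.of_forall fun q hq => hB (s, q) ⟨⟨hs.1.le, hs.2.le⟩, ?_⟩
    rw [Set.uIoc_of_le (by positivity)] at hq
    exact ⟨hq.1.le, hq.2⟩
  · refine Eventually.of_forall fun q _ => ?_
    have h1 : ContinuousAt (Function.uncurry (D.F j)) (t, q) :=
      (D.cont_F j).continuousAt (prod_mem_nhds (Iio_mem_nhds ht) univ_mem)
    exact ContinuousAt.comp (f := fun s : ℝ => (s, q)) h1 (by fun_prop)

/-- Existence of a slice on which the nonradial part is small. -/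
lemma exists_good_slice (hc₁ : 0 < c₁) (hA0 : ∀ i j, 0 ≤ A i j) {a ε : ℝ} (ha : a + 2 < T₀)
    (hε : 0 < ε) (hosc : ∀ t ∈ Set.Icc a (a + 2), ∀ i q q', |D.U i t q - D.U i t q'| ≤ ε)
    (hF : ∀ t ∈ Set.Icc a (a + 2), ∀ i q, D.F i t q ≤ ε) :
    ∃ t ∈ Set.Icc a (a + 2), D.S t ≤ (n + 1) * (2 + ∑ i, ∑ j, A i j) * ε ^ 2 := by
  set g : ℝ → ℝ := fun t => ∑ i, circleMean fun q => (D.U i t q - D.φ i t) ^ 2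
  set g1 : ℝ → ℝ := fun t => ∑ i, circleMean fun q =>
    2 * (D.U i t q - D.φ i t) * (D.Ut i t q - D.φt i t)
  set g2 : ℝ → ℝ := fun t => ∑ i, circleMean fun q =>
    2 * ((D.Ut i t q - D.φt i t) * (D.Ut i t q - D.φt i t) +
      (D.U i t q - D.φ i t) * (D.Utt i t q - (-∑ j, A i j * D.Fm j t)))
  have hlt : ∀ t ∈ Set.Icc a (a + 2), t < T₀ := fun t ht => ht.2.trans_lt ha
  have cφ : ∀ i, ContinuousOn (fun p : ℝ × ℝ => D.φ i p.1) (Set.Iio T₀ ×ˢ Set.univ) :=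
    fun i => cont_fst fun t ht => D.hasDerivAt_φ i ht
  have cφt : ∀ i, ContinuousOn (fun p : ℝ × ℝ => D.φt i p.1) (Set.Iio T₀ ×ˢ Set.univ) :=
    fun i => cont_fst fun t ht => D.hasDerivAt_φt i ht
  have cFm : ∀ i, ContinuousOn (fun p : ℝ × ℝ => D.Fm i p.1) (Set.Iio T₀ ×ˢ Set.univ) :=
    fun i => (D.continuousOn_Fm i).comp (by fun_prop) fun p hp => hp.1
  have hg : ∀ t < T₀, HasDerivAt g (g1 t) t := by
    intro t ht
    refine HasDerivAt.fun_sum fun i _ => ?_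
    refine hasDerivAt_circleMean (T₀ := T₀)
      (f := fun t q => (D.U i t q - D.φ i t) ^ 2)
      (f' := fun t q => 2 * (D.U i t q - D.φ i t) * (D.Ut i t q - D.φt i t)) ?_ ?_ ?_ ht
    · intro s hs
      have := D.continuous_U i hs.le
      fun_prop
    · intro s hs q
      have := ((D.dU_t i s hs q).sub (D.hasDerivAt_φ i hs)).pow 2
      exact this.congr_deriv (by simp)
    · exact (continuousOn_const.mul ((D.cont_U' i).sub (cφ i))).mul ((D.cont_Ut i).sub (cφt i))
  have hg1 : ∀ t < T₀, HasDerivAt g1 (g2 t) t := by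
    intro t ht
    refine HasDerivAt.fun_sum fun i _ => ?_
    refine hasDerivAt_circleMean (T₀ := T₀)
      (f := fun t q => 2 * (D.U i t q - D.φ i t) * (D.Ut i t q - D.φt i t))
      (f' := fun t q => 2 * ((D.Ut i t q - D.φt i t) * (D.Ut i t q - D.φt i t) +
      (D.U i t q - D.φ i t) * (D.Utt i t q - (-∑ j, A i j * D.Fm j t)))) ?_ ?_ ?_ ht
    · intro s hs
      have := D.continuous_U i hs.le
      have := D.continuous_Ut i hs
      fun_prop
    · intro s hs q
      have := (((D.dU_t i s hs q).sub (D.hasDerivAt_φ i hs)).const_mul 2).mul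
        ((D.dUt_t i s hs q).sub (D.hasDerivAt_φt i hs))
      exact this.congr_deriv (by simp only [Pi.sub_apply]; ring)
    · have h1 := (D.cont_Ut i).sub (cφt i)
      have h2 := (D.cont_U' i).sub (cφ i)
      have h3 : ContinuousOn (fun p : ℝ × ℝ => ∑ j, A i j * D.Fm j p.1)
          (Set.Iio T₀ ×ˢ Set.univ) :=
        continuousOn_finsetSum _ fun j _ => continuousOn_const.mul (cFm j)
      exact continuousOn_const.mul ((h1.mul h1).add (h2.mul ((D.cont_Utt i).sub h3.neg)))
  have hw : ∀ t ∈ Set.Icc a (a + 2), ∀ i q, |D.U i t q - D.φ i t| ≤ ε := fun t ht i q =>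
    D.abs_U_sub_φ_le i (hlt t ht).le (hosc t ht i) q
  obtain ⟨t, ht, hle⟩ := exists_second_deriv_le (g := g) (g' := g1) (g'' := g2) (a := a)
    (ε := (n + 1) * ε ^ 2) (by positivity) (fun t ht => hg t (hlt t ht))
    (fun t ht => hg1 t (hlt t ht))
    (fun t ht => Finset.sum_nonneg fun i _ => le_circleMean (by
      have := D.continuous_U i (hlt t ht).le
      fun_prop) fun q => by positivity)
    (fun t ht => by
      calc g t ≤ ∑ i : Fin n, ε ^ 2 := Finset.sum_le_sum fun i _ => circleMean_le (by
            have := D.continuous_U i (hlt t ht).le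
            fun_prop) fun q => sq_le_sq' (by linarith [(abs_le.mp (hw t ht i q)).1])
              (abs_le.mp (hw t ht i q)).2
        _ = n * ε ^ 2 := by simp
        _ ≤ _ := by nlinarith [sq_nonneg ε])
  refine ⟨t, ht, ?_⟩
  have htT := hlt t ht
  have hs := sum_sum_nonneg hA0
  set α := ∑ i, ∑ j, A i j with hα
  have hi : ∀ i, 2 * circleMean (fun q => (D.Ut i t q - D.φt i t) ^ 2 + D.Uq i t q ^ 2)
      - 2 * (α * ε ^ 2) ≤ circleMean (fun q =>
    2 * ((D.Ut i t q - D.φt i t) * (D.Ut i t q - D.φt i t) +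
      (D.U i t q - D.φ i t) * (D.Utt i t q - (-∑ j, A i j * D.Fm j t)))) := by
    intro i
    have c1 := D.continuous_U i htT.le
    have c2 := D.continuous_Ut i htT
    have c3 := D.continuous_Utt i htT
    have c4 := D.continuous_Uq i htT
    have c5 := D.continuous_Uqq i htT
    have c6 := D.continuous_sum_F i htT
    have z : circleMean (fun q => D.Uq i t q * D.Uq i t q +
        (D.U i t q - D.φ i t) * D.Uqq i t q) = 0 := by
      refine circleMean_deriv_eq_zero (f := fun q => (D.U i t q - D.φ i t) * D.Uq i t q) ?_
        (by fun_prop) ?_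
      · intro q
        exact ((D.dU_q i t htT q).sub_const _).mul (D.dUq_q i t htT q)
      · intro q
        simp only [D.per_U i t q, D.per_Uq i t q]
    have e : (fun q => 2 * ((D.Ut i t q - D.φt i t) * (D.Ut i t q - D.φt i t) +
        (D.U i t q - D.φ i t) * (D.Utt i t q - (-∑ j, A i j * D.Fm j t)))) =
        fun q => (2 * ((D.Ut i t q - D.φt i t) ^ 2 + D.Uq i t q ^ 2) -
          2 * (D.Uq i t q * D.Uq i t q + (D.U i t q - D.φ i t) * D.Uqq i t q)) -
          2 * ((D.U i t q - D.φ i t) * ((∑ j, A i j * D.F j t q) - ∑ j, A i j * D.Fm j t)) := by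
      funext q
      rw [D.Utt_eq i htT q]; ring
    rw [e, circleMean_sub (by fun_prop) (by fun_prop), circleMean_sub (by fun_prop) (by fun_prop),
      circleMean_const_mul, circleMean_const_mul, circleMean_const_mul, z]
    have hbd : circleMean (fun q => (D.U i t q - D.φ i t) *
        ((∑ j, A i j * D.F j t q) - ∑ j, A i j * D.Fm j t)) ≤ α * ε ^ 2 := by
      refine circleMean_le (by fun_prop) fun q => ?_
      have hb := D.sum_F_bounds hc₁ hA0 i (η := ε) htT hε.le (hF t ht)
      have hm0 : 0 ≤ ∑ j, A i j * D.Fm j t := by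
        rw [← D.circleMean_sum_F i htT]; exact le_circleMean c6 fun q => (hb q).1
      have hm1 : ∑ j, A i j * D.Fm j t ≤ α * ε := by
        rw [← D.circleMean_sum_F i htT]; exact circleMean_le c6 fun q => (hb q).2
      have h1 : |(∑ j, A i j * D.F j t q) - ∑ j, A i j * D.Fm j t| ≤ α * ε := by
        rw [abs_le]; constructor <;> linarith [(hb q).1, (hb q).2]
      calc _ ≤ |(D.U i t q - D.φ i t) * ((∑ j, A i j * D.F j t q) - ∑ j, A i j * D.Fm j t)| :=
            le_abs_self _
        _ ≤ ε * (α * ε) := by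
            rw [abs_mul]
            exact mul_le_mul (hw t ht i q) h1 (abs_nonneg _) hε.le
        _ = α * ε ^ 2 := by ring
    linarith
  have hsum := Finset.sum_le_sum fun i (_ : i ∈ Finset.univ) => hi i
  rw [Finset.sum_sub_distrib, ← Finset.mul_sum] at hsum
  have hS : 2 * D.S t - n * (2 * (α * ε ^ 2)) ≤ g2 t := by
    refine le_trans (le_of_eq ?_) hsum
    simp [S]
  nlinarith [mul_nonneg hs (sq_nonneg ε)]

/-- The Pohozaev functional of a slice. -/
def H (t : ℝ) : ℝ := circleMean fun q =>
  1 / 2 * (∑ i, ∑ j, A⁻¹ i j * (D.Ut i t q * D.Ut j t q - D.Uq i t q * D.Uq j t q)) +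
    ∑ i, D.F i t q

lemma hasDerivAt_H (hA : IsUnit A.det) (hsymm : A.IsSymm) {t : ℝ} (ht : t < T₀) :
    HasDerivAt D.H (∑ i, circleMean fun q => D.ht i t q * Real.exp (D.U i t q)) t := by
  have hsymm' : ∀ i j, A⁻¹ i j = A⁻¹ j i := fun i j => hsymm.inv.apply j i
  have hd := hasDerivAt_circleMean (T₀ := T₀)
    (f := fun t q => 1 / 2 * (∑ i, ∑ j, A⁻¹ i j * (D.Ut i t q * D.Ut j t q -
      D.Uq i t q * D.Uq j t q)) + ∑ i, D.F i t q)
    (f' := fun t q => 1 / 2 * (∑ i, ∑ j, A⁻¹ i j * ((D.Utt i t q * D.Ut j t q +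
      D.Ut i t q * D.Utt j t q) - (D.Utq i t q * D.Uq j t q + D.Uq i t q * D.Utq j t q))) +
      ∑ i, (D.ht i t q * Real.exp (D.U i t q) +
        D.h i t q * (Real.exp (D.U i t q) * D.Ut i t q))) ?_ ?_ ?_ ht
  · refine hd.congr_deriv ?_
    have e : ∀ q, 1 / 2 * (∑ i, ∑ j, A⁻¹ i j * ((D.Utt i t q * D.Ut j t q +
      D.Ut i t q * D.Utt j t q) - (D.Utq i t q * D.Uq j t q + D.Uq i t q * D.Utq j t q))) +
      ∑ i, (D.ht i t q * Real.exp (D.U i t q) +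
        D.h i t q * (Real.exp (D.U i t q) * D.Ut i t q)) =
      (∑ i, D.ht i t q * Real.exp (D.U i t q)) -
        ∑ i, ∑ j, A⁻¹ i j * (D.Utq i t q * D.Uq j t q + D.Ut i t q * D.Uqq j t q) := by
      intro q
      have e1 : ∑ i, ∑ j, A⁻¹ i j * ((D.Utt i t q * D.Ut j t q +
          D.Ut i t q * D.Utt j t q) - (D.Utq i t q * D.Uq j t q + D.Uq i t q * D.Utq j t q)) =
          2 * ∑ i, ∑ j, A⁻¹ i j * (D.Ut i t q * D.Utt j t q - D.Utq i t q * D.Uq j t q) := by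
        have sw : ∑ i, ∑ j, A⁻¹ i j * (D.Utt i t q * D.Ut j t q - D.Uq i t q * D.Utq j t q) =
            ∑ i, ∑ j, A⁻¹ i j * (D.Ut i t q * D.Utt j t q - D.Utq i t q * D.Uq j t q) := by
          rw [Finset.sum_comm]
          refine Finset.sum_congr rfl fun i _ => Finset.sum_congr rfl fun j _ => ?_
          rw [hsymm' j i]; ring
        rw [two_mul]
        nth_rewrite 1 [← sw]
        simp only [← Finset.sum_add_distrib]
        refine Finset.sum_congr rfl fun i _ => Finset.sum_congr rfl fun j _ => ?_
        ring
      have e2 : ∀ i, ∑ j, A⁻¹ i j * (∑ l, A j l * D.F l t q) = D.F i t q := by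
        intro i
        have h1 : (A⁻¹).mulVec (A.mulVec (fun l => D.F l t q)) = fun l => D.F l t q := by
          rw [Matrix.mulVec_mulVec, Matrix.nonsing_inv_mul _ hA, Matrix.one_mulVec]
        have := congrFun h1 i
        simpa [Matrix.mulVec, dotProduct] using this
      rw [e1]
      have e3 : ∀ i, ∑ j, A⁻¹ i j * (D.Ut i t q * D.Utt j t q - D.Utq i t q * D.Uq j t q) =
          -(∑ j, A⁻¹ i j * (D.Utq i t q * D.Uq j t q + D.Ut i t q * D.Uqq j t q)) -
            D.h i t q * (Real.exp (D.U i t q) * D.Ut i t q) := by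
        intro i
        have : D.h i t q * (Real.exp (D.U i t q) * D.Ut i t q) =
            ∑ j, D.Ut i t q * (A⁻¹ i j * (∑ l, A j l * D.F l t q)) := by
          rw [← Finset.mul_sum, e2 i, F]; ring
        rw [this, ← Finset.sum_neg_distrib, ← Finset.sum_sub_distrib]
        refine Finset.sum_congr rfl fun j _ => ?_
        rw [D.Utt_eq j ht q]; ring
      rw [Finset.sum_congr rfl fun i _ => e3 i, Finset.sum_sub_distrib, Finset.sum_neg_distrib,
        Finset.sum_add_distrib]
      ring
    have z : ∀ i j, circleMean (fun q => D.Utq i t q * D.Uq j t q + D.Ut i t q * D.Uqq j t q)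
        = 0 := by
      intro i j
      have c1 := D.continuous_Ut i ht
      have c2 := D.continuous_Utq i ht
      have c3 := D.continuous_Uq j ht
      have c4 := D.continuous_Uqq j ht
      refine circleMean_deriv_eq_zero (f := fun q => D.Ut i t q * D.Uq j t q) ?_
        (by fun_prop) ?_
      · intro q
        exact (D.dUt_q i t ht q).mul (D.dUq_q j t ht q)
      · intro q
        simp only [D.per_Ut i t q, D.per_Uq j t q]
    have cz : ∀ i j, Continuous
        (fun q => D.Utq i t q * D.Uq j t q + D.Ut i t q * D.Uqq j t q) := fun i j =>
      ((D.continuous_Utq i ht).mul (D.continuous_Uq j ht)).add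
        ((D.continuous_Ut i ht).mul (D.continuous_Uqq j ht))
    have ch : ∀ i, Continuous (fun q => D.ht i t q * Real.exp (D.U i t q)) := fun i =>
      (continuous_slice (D.cont_ht i) ht).mul (D.continuous_U i ht.le).rexp
    simp only [e]
    have cs : ∀ i, Continuous fun q => ∑ j, A⁻¹ i j *
        (D.Utq i t q * D.Uq j t q + D.Ut i t q * D.Uqq j t q) := fun i =>
      continuous_finsetSum _ fun j _ => (cz i j).const_mul _
    rw [circleMean_sub (f := fun q => ∑ i, D.ht i t q * Real.exp (D.U i t q))
      (g := fun q => ∑ i, ∑ j, A⁻¹ i j * (D.Utq i t q * D.Uq j t q + D.Ut i t q * D.Uqq j t q))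
      (continuous_finsetSum _ fun i _ => ch i) (continuous_finsetSum _ fun i _ => cs i),
      circleMean_sum _ fun i _ => ch i, circleMean_sum _ fun i _ => cs i]
    have : ∀ i, circleMean (fun q => ∑ j, A⁻¹ i j *
        (D.Utq i t q * D.Uq j t q + D.Ut i t q * D.Uqq j t q)) = 0 := by
      intro i
      rw [circleMean_sum _ fun j _ => (cz i j).const_mul _]
      simp only [circleMean_const_mul, z, mul_zero, Finset.sum_const_zero]
    simp [this]
  · intro s hs
    have c1 := fun i => D.continuous_Ut i hs
    have c2 := fun i => D.continuous_Uq i hs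
    have c3 := fun i => D.continuous_F i hs
    fun_prop
  · intro s hs q
    refine HasDerivAt.add (HasDerivAt.const_mul _ ?_) ?_
    · refine HasDerivAt.fun_sum fun i _ => HasDerivAt.fun_sum fun j _ => HasDerivAt.const_mul _ ?_
      exact ((D.dUt_t i s hs q).mul (D.dUt_t j s hs q)).sub
        ((D.dUq_t i s hs q).mul (D.dUq_t j s hs q))
    · refine HasDerivAt.fun_sum fun i _ => ?_
      exact (D.dh_t i s hs q).mul (D.dU_t i s hs q).exp
  · refine ContinuousOn.add (continuousOn_const.mul ?_) ?_
    · refine continuousOn_finsetSum _ fun i _ => continuousOn_finsetSum _ fun j _ =>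
        continuousOn_const.mul ?_
      exact (((D.cont_Utt i).mul (D.cont_Ut j)).add ((D.cont_Ut i).mul (D.cont_Utt j))).sub
        (((D.cont_Utq i).mul (D.cont_Uq j)).add ((D.cont_Uq i).mul (D.cont_Utq j)))
    · refine continuousOn_finsetSum _ fun i _ => ?_
      exact ((D.cont_ht i).mul (D.cont_U' i).rexp).add
        ((D.cont_h i).mul ((D.cont_U' i).rexp.mul (D.cont_Ut i)))

end CylinderSolution

namespace CylinderSolution

variable {n : ℕ} {A : Matrix (Fin n) (Fin n) ℝ} {μ T₀ c₁ c₂ c₃ C : ℝ}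
  (D : CylinderSolution A μ T₀ c₁ c₂ c₃ C)

lemma continuous_S_summand (i : Fin n) {t : ℝ} (ht : t < T₀) :
    Continuous fun q => (D.Ut i t q - D.φt i t) ^ 2 + D.Uq i t q ^ 2 := by
  have := D.continuous_Ut i ht
  have := D.continuous_Uq i ht
  fun_prop

/-- The radial part of the Pohozaev functional. -/
def Q (t : ℝ) : ℝ := 1 / 2 * ∑ i, ∑ j, A⁻¹ i j * (D.φt i t * D.φt j t)

lemma abs_H_sub_Q_le (hc₁ : 0 < c₁) {t : ℝ} (ht : t < T₀) :
    |D.H t - D.Q t| ≤ (∑ i, ∑ j, |A⁻¹ i j|) * D.S t + ∑ i, D.Fm i t := by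
  have c1 := fun i => D.continuous_Ut i ht
  have c2 := fun i => D.continuous_Uq i ht
  have c3 := fun i => D.continuous_F i ht
  have cS := fun i => D.continuous_S_summand i ht
  set s : Fin n → ℝ := fun i =>
    circleMean fun q => (D.Ut i t q - D.φt i t) ^ 2 + D.Uq i t q ^ 2 with hs
  have hs0 : ∀ i, 0 ≤ s i := fun i => le_circleMean (cS i) fun q => by positivity
  have hsS : ∀ i, s i ≤ D.S t := fun i =>
    Finset.single_le_sum (f := s) (fun i _ => hs0 i) (Finset.mem_univ i)
  have hij : ∀ i j, |circleMean (fun q => D.Ut i t q * D.Ut j t q - D.Uq i t q * D.Uq j t q) -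
      D.φt i t * D.φt j t| ≤ 2 * D.S t := by
    intro i j
    have hp : ∀ l, circleMean (fun q => D.Ut l t q - D.φt l t) = 0 := by
      intro l
      rw [circleMean_sub (c1 l) continuous_const, circleMean_const, φt, sub_self]
    have e : circleMean (fun q => D.Ut i t q * D.Ut j t q - D.Uq i t q * D.Uq j t q) -
        D.φt i t * D.φt j t = circleMean (fun q =>
        (D.Ut i t q - D.φt i t) * (D.Ut j t q - D.φt j t) - D.Uq i t q * D.Uq j t q) := by
      have : (fun q => (D.Ut i t q - D.φt i t) * (D.Ut j t q - D.φt j t) -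
          D.Uq i t q * D.Uq j t q) = fun q =>
          (D.Ut i t q * D.Ut j t q - D.Uq i t q * D.Uq j t q) -
          (D.φt i t * D.φt j t + (D.φt i t * (D.Ut j t q - D.φt j t) +
            D.φt j t * (D.Ut i t q - D.φt i t))) := by
        funext q; ring
      have k1 : Continuous fun q => D.φt i t * (D.Ut j t q - D.φt j t) := by fun_prop
      have k2 : Continuous fun q => D.φt j t * (D.Ut i t q - D.φt i t) := by fun_prop
      have k3 : Continuous fun q => D.Ut i t q * D.Ut j t q - D.Uq i t q * D.Uq j t q := by
        fun_prop
      have k4 : Continuous fun q => D.φt i t * (D.Ut j t q - D.φt j t) +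
          D.φt j t * (D.Ut i t q - D.φt i t) := by fun_prop
      have k5 : Continuous fun q => D.φt i t * D.φt j t + (D.φt i t * (D.Ut j t q - D.φt j t) +
          D.φt j t * (D.Ut i t q - D.φt i t)) := by fun_prop
      have k6 : Continuous fun _ : ℝ => D.φt i t * D.φt j t := continuous_const
      rw [this, circleMean_sub k3 k5, circleMean_add k6 k4, circleMean_add k1 k2, circleMean_const,
        circleMean_const_mul, circleMean_const_mul, hp, hp]
      ring
    rw [e]
    calc _ ≤ circleMean (fun q => ((D.Ut i t q - D.φt i t) ^ 2 + D.Uq i t q ^ 2) +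
          ((D.Ut j t q - D.φt j t) ^ 2 + D.Uq j t q ^ 2)) := by
          refine abs_circleMean_le (by fun_prop) (by fun_prop) fun q => ?_
          rw [abs_le]
          constructor <;>
          nlinarith [sq_nonneg ((D.Ut i t q - D.φt i t) + (D.Ut j t q - D.φt j t)),
            sq_nonneg ((D.Ut i t q - D.φt i t) - (D.Ut j t q - D.φt j t)),
            sq_nonneg (D.Uq i t q + D.Uq j t q), sq_nonneg (D.Uq i t q - D.Uq j t q),
            sq_nonneg (D.Ut i t q - D.φt i t), sq_nonneg (D.Ut j t q - D.φt j t),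
            sq_nonneg (D.Uq i t q), sq_nonneg (D.Uq j t q)]
      _ = s i + s j := circleMean_add (cS i) (cS j)
      _ ≤ 2 * D.S t := by linarith [hsS i, hsS j]
  have eH : D.H t = 1 / 2 * (∑ i, ∑ j, A⁻¹ i j *
      circleMean (fun q => D.Ut i t q * D.Ut j t q - D.Uq i t q * D.Uq j t q)) +
      ∑ i, D.Fm i t := by
    have k : ∀ i, Continuous fun q => ∑ j, A⁻¹ i j *
      (D.Ut i t q * D.Ut j t q - D.Uq i t q * D.Uq j t q) := fun i => by fun_prop
    have k' : Continuous fun q => 1 / 2 * ∑ i, ∑ j, A⁻¹ i j *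
      (D.Ut i t q * D.Ut j t q - D.Uq i t q * D.Uq j t q) := by fun_prop
    have k'' : Continuous fun q => ∑ i, D.F i t q := by fun_prop
    rw [H, circleMean_add k' k'', circleMean_const_mul, circleMean_sum _ fun i _ => k i,
      circleMean_sum _ fun i _ => c3 i]
    congr 2
    refine Finset.sum_congr rfl fun i _ => ?_
    rw [circleMean_sum _ fun j _ => by fun_prop]
    simp only [circleMean_const_mul]
  have eq : D.H t - D.Q t = 1 / 2 * (∑ i, ∑ j, A⁻¹ i j *
      (circleMean (fun q => D.Ut i t q * D.Ut j t q - D.Uq i t q * D.Uq j t q) -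
        D.φt i t * D.φt j t)) + ∑ i, D.Fm i t := by
    rw [eH, Q]
    simp only [mul_sub, Finset.sum_sub_distrib]
    ring
  have hFm : 0 ≤ ∑ i, D.Fm i t := Finset.sum_nonneg fun i _ => D.Fm_nonneg hc₁ i ht
  have hmain : |∑ i, ∑ j, A⁻¹ i j *
      (circleMean (fun q => D.Ut i t q * D.Ut j t q - D.Uq i t q * D.Uq j t q) -
        D.φt i t * D.φt j t)| ≤ (∑ i, ∑ j, |A⁻¹ i j|) * (2 * D.S t) := by
    rw [Finset.sum_mul]
    refine (Finset.abs_sum_le_sum_abs _ _).trans (Finset.sum_le_sum fun i _ => ?_)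
    rw [Finset.sum_mul]
    refine (Finset.abs_sum_le_sum_abs _ _).trans (Finset.sum_le_sum fun j _ => ?_)
    rw [abs_mul]
    exact mul_le_mul_of_nonneg_left (hij i j) (abs_nonneg _)
  rw [eq]
  refine (abs_add_le _ _).trans ?_
  rw [abs_of_nonneg hFm, abs_mul, abs_of_pos (by norm_num : (0:ℝ) < 1 / 2)]
  linarith

lemma Q_eq (hA : IsUnit A.det) (hsymm : A.IsSymm) (t : ℝ) :
    D.Q t = 2 * μ ^ 2 * (∑ i, ∑ j, A⁻¹ i j) +
      1 / 2 * ((∑ i, ∑ j, A i j * D.σ i t * D.σ j t) - 4 * μ * ∑ i, D.σ i t) := by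
  have hsymm' : ∀ i j, A⁻¹ i j = A⁻¹ j i := fun i j => hsymm.inv.apply j i
  have hφ : ∀ i, D.φt i t = 2 * μ - ∑ j, A i j * D.σ j t := fun i => by
    rw [D.sum_mul_σ hA]; ring
  set m : Fin n → ℝ := fun i => ∑ j, A i j * D.σ j t with hm
  have hσ : ∀ i, D.σ i t = ∑ j, A⁻¹ i j * m j := fun i => by
    rw [σ]
    exact Finset.sum_congr rfl fun j _ => by rw [hφ j]; simp only [hm]; ring
  have e0 : ∑ i, ∑ j, A i j * D.σ i t * D.σ j t = ∑ i, D.σ i t * m i := by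
    refine Finset.sum_congr rfl fun i _ => ?_
    rw [hm, Finset.mul_sum]
    exact Finset.sum_congr rfl fun j _ => by ring
  have e1 : ∑ i, ∑ j, A⁻¹ i j * (m i * m j) = ∑ i, D.σ i t * m i := by
    refine Finset.sum_congr rfl fun i _ => ?_
    rw [hσ i, Finset.sum_mul]
    exact Finset.sum_congr rfl fun j _ => by ring
  have e2 : ∑ i, ∑ j, A⁻¹ i j * m j = ∑ i, D.σ i t :=
    Finset.sum_congr rfl fun i _ => (hσ i).symm
  have e3 : ∑ i, ∑ j, A⁻¹ i j * m i = ∑ i, D.σ i t := by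
    rw [← e2, Finset.sum_comm]
    exact Finset.sum_congr rfl fun i _ => Finset.sum_congr rfl fun j _ => by rw [hsymm' j i]
  have e4 : ∑ i, ∑ j, A⁻¹ i j * (D.φt i t * D.φt j t) =
      4 * μ ^ 2 * (∑ i, ∑ j, A⁻¹ i j) - 2 * μ * (∑ i, ∑ j, A⁻¹ i j * m i) -
        2 * μ * (∑ i, ∑ j, A⁻¹ i j * m j) + ∑ i, ∑ j, A⁻¹ i j * (m i * m j) := by
    simp only [Finset.mul_sum, ← Finset.sum_sub_distrib, ← Finset.sum_add_distrib]
    refine Finset.sum_congr rfl fun i _ => Finset.sum_congr rfl fun j _ => ?_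
    rw [hφ i, hφ j]; ring
  rw [Q, e4, e3, e2, e1, e0]
  ring

lemma abs_H_sub_H_le (hA : IsUnit A.det) (hsymm : A.IsSymm) (hc₁ : 0 < c₁) (hc₃ : 0 ≤ c₃)
    {s t : ℝ} (hst : s ≤ t) (ht : t < T₀) :
    |D.H t - D.H s| ≤ c₃ * Real.exp t / c₁ * ∑ i, (D.σ i t - D.σ i s) := by
  set κ := c₃ * Real.exp t / c₁ with hκ
  have hκ0 : 0 ≤ κ := by positivity
  have hlt : ∀ r ∈ Set.Icc s t, r < T₀ := fun r hr => hr.2.trans_lt ht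
  have hbd : ∀ r ∈ Set.Icc s t,
      |∑ i, circleMean fun q => D.ht i r q * Real.exp (D.U i r q)| ≤ κ * ∑ i, D.Fm i r := by
    intro r hr
    rw [Finset.mul_sum]
    refine (Finset.abs_sum_le_sum_abs _ _).trans (Finset.sum_le_sum fun i _ => ?_)
    have c1 := continuous_slice (D.cont_ht i) (hlt r hr)
    have c2 := D.continuous_U i (hlt r hr).le
    have c3 := D.continuous_F i (hlt r hr)
    rw [Fm, ← circleMean_const_mul]
    refine abs_circleMean_le (by fun_prop) (by fun_prop) fun q => ?_
    rw [abs_mul, abs_of_pos (Real.exp_pos _), F, ← mul_assoc]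
    refine mul_le_mul_of_nonneg_right ?_ (Real.exp_pos _).le
    calc |D.ht i r q| ≤ c₃ * Real.exp r := D.ht_le i r (hlt r hr) q
      _ ≤ c₃ * Real.exp t := mul_le_mul_of_nonneg_left (Real.exp_le_exp.mpr hr.2) hc₃
      _ = κ * c₁ := by rw [hκ]; field_simp
      _ ≤ κ * D.h i r q := mul_le_mul_of_nonneg_left (D.h_lb i r (hlt r hr) q) hκ0
  have hσd : ∀ r ∈ Set.Icc s t, HasDerivAt (fun r => κ * ∑ i, D.σ i r) (κ * ∑ i, D.Fm i r) r :=
    fun r hr => (HasDerivAt.fun_sum fun i _ => D.hasDerivAt_σ hA i (hlt r hr)).const_mul κ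
  have hHd := fun r (hr : r ∈ Set.Icc s t) => D.hasDerivAt_H hA hsymm (hlt r hr)
  have key : ∀ (f f' : ℝ → ℝ), (∀ r ∈ Set.Icc s t, HasDerivAt f (f' r) r) →
      (∀ r ∈ Set.Icc s t, 0 ≤ f' r) → f s ≤ f t := by
    intro f f' hf hf'
    refine monotoneOn_of_hasDerivWithinAt_nonneg (f' := f') (convex_Icc s t)
      (fun r hr => (hf r hr).continuousAt.continuousWithinAt)
      (fun r hr => (hf r (interior_subset hr)).hasDerivWithinAt)
      (fun r hr => hf' r (interior_subset hr)) ⟨le_rfl, hst⟩ ⟨hst, le_rfl⟩ hst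
  have h1 := key _ _ (fun r hr => (hσd r hr).sub (hHd r hr)) fun r hr => by
    linarith [(abs_le.mp (hbd r hr)).2]
  have h2 := key _ _ (fun r hr => (hσd r hr).add (hHd r hr)) fun r hr => by
    linarith [(abs_le.mp (hbd r hr)).1]
  simp only [Pi.sub_apply, Pi.add_apply] at h1 h2
  rw [Finset.sum_sub_distrib, mul_sub, abs_le]
  constructor <;> linarith

lemma sum_Fm_le {t ε : ℝ} (ht : t < T₀) (hF : ∀ i q, D.F i t q ≤ ε) :
    ∑ i, D.Fm i t ≤ n * ε := by
  calc ∑ i, D.Fm i t ≤ ∑ i : Fin n, ε :=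
        Finset.sum_le_sum fun i _ => circleMean_le (D.continuous_F i ht) (hF i)
    _ = n * ε := by simp

lemma exists_H_near (hc₁ : 0 < c₁) (hμ : 0 < μ) (hA0 : ∀ i j, 0 ≤ A i j)
    {ε T : ℝ} (hε : 0 < ε) : ∃ t < T, |D.H t - 2 * μ ^ 2 * ∑ i, ∑ j, A⁻¹ i j| ≤
      (∑ i, ∑ j, |A⁻¹ i j|) * ((n + 1) * (2 + ∑ i, ∑ j, A i j) * ε ^ 2) + n * ε + ε := by
  have hQ : Tendsto D.Q atBot (nhds (2 * μ ^ 2 * ∑ i, ∑ j, A⁻¹ i j)) := by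
    have h1 : Tendsto D.Q atBot
        (nhds (1 / 2 * ∑ i, ∑ j, A⁻¹ i j * ((2 * μ) * (2 * μ)))) :=
      (tendsto_finsetSum _ fun i _ => tendsto_finsetSum _ fun j _ =>
        ((D.tendsto_φt hc₁ hA0 i).mul (D.tendsto_φt hc₁ hA0 j)).const_mul _).const_mul _
    refine h1.congr' ?_ |>.trans (le_of_eq ?_)
    · exact EventuallyEq.rfl
    · simp only [← Finset.sum_mul]; congr 1; ring
  have hosc : ∀ᶠ t in atBot, ∀ i, ∀ q q', |D.U i t q - D.U i t q'| ≤ ε := by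
    refine eventually_all.mpr fun i => ?_
    obtain ⟨T₁, hT₁⟩ := D.lim i (ε / 2) (by positivity)
    filter_upwards [Iic_mem_atBot T₁] with t ht q q'
    have h1 := abs_le.mp (hT₁ t ht q)
    have h2 := abs_le.mp (hT₁ t ht q')
    rw [abs_le]; constructor <;> linarith [h1.1, h1.2, h2.1, h2.2]
  have hF : ∀ᶠ t in atBot, ∀ i, ∀ q, D.F i t q ≤ ε := by
    refine eventually_all.mpr fun i => ?_
    obtain ⟨T₁, hT₁⟩ := D.lim i 1 one_pos
    have hlim : Tendsto (fun t => c₂ * Real.exp (2 * μ * t + (D.u₀ i + 1))) atBot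
        (nhds (c₂ * 0)) := by
      refine (Real.tendsto_exp_atBot.comp ?_).const_mul _
      exact tendsto_atBot_add_const_right _ _ (tendsto_id.const_mul_atBot (by positivity))
    rw [mul_zero] at hlim
    filter_upwards [Iic_mem_atBot T₁, Iio_mem_atBot T₀, hlim.eventually_le_const hε]
      with t ht ht' ht'' q
    refine (D.F_le i ht' q).trans (le_trans ?_ ht'')
    exact mul_le_mul_of_nonneg_left (Real.exp_le_exp.mpr (by
      linarith [(abs_le.mp (hT₁ t ht q)).2])) (D.c₂_pos hc₁ i).le
  have hQ' := Metric.tendsto_nhds.mp hQ ε hε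
  obtain ⟨T₁, hT₁⟩ := eventually_atBot.mp (hosc.and (hF.and (hQ'.and
    ((eventually_lt_atBot T).and (eventually_lt_atBot T₀)))))
  have hle : ∀ t ∈ Set.Icc (T₁ - 2) (T₁ - 2 + 2), t ≤ T₁ := fun t ht => by linarith [ht.2]
  obtain ⟨t, ht, hS⟩ := D.exists_good_slice hc₁ hA0 (a := T₁ - 2) (ε := ε)
    (by linarith [(hT₁ T₁ le_rfl).2.2.2.2]) hε (fun t ht => (hT₁ t (hle t ht)).1)
    (fun t ht => (hT₁ t (hle t ht)).2.1)
  have h := hT₁ t (hle t ht)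
  refine ⟨t, h.2.2.2.1, ?_⟩
  have h1 := D.abs_H_sub_Q_le hc₁ h.2.2.2.2
  have h2 := D.sum_Fm_le h.2.2.2.2 h.2.1
  have h3 := h.2.2.1
  rw [Real.dist_eq] at h3
  have h4 := abs_sub_le (D.H t) (D.Q t) (2 * μ ^ 2 * ∑ i, ∑ j, A⁻¹ i j)
  have h5 := mul_le_mul_of_nonneg_left hS
    (Finset.sum_nonneg fun i _ => Finset.sum_nonneg fun j _ => abs_nonneg _ :
      0 ≤ ∑ i, ∑ j, |A⁻¹ i j|)
  linarith

/-- Approximate Pohozaev identity on a slice of a short cylinder where the solution is nearly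
radial and the nonlinearity is small. -/
lemma exists_abs_pohozaev_le (hA : IsUnit A.det) (hsymm : A.IsSymm) (hc₁ : 0 < c₁) (hμ : 0 < μ)
    (hc₃ : 0 ≤ c₃) (hA0 : ∀ i j, 0 ≤ A i j) {a ε : ℝ} (ha : a + 2 < T₀)
    (hε : 0 < ε) (hosc : ∀ t ∈ Set.Icc a (a + 2), ∀ i q q', |D.U i t q - D.U i t q'| ≤ ε)
    (hF : ∀ t ∈ Set.Icc a (a + 2), ∀ i q, D.F i t q ≤ ε) :
    ∃ t ∈ Set.Icc a (a + 2),
      |(∑ i, ∑ j, A i j * D.σ i t * D.σ j t) - 4 * μ * ∑ i, D.σ i t| ≤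
      2 * ((∑ i, ∑ j, |A⁻¹ i j|) * ((n + 1) * (2 + ∑ i, ∑ j, A i j) * ε ^ 2) + n * ε +
        c₃ * Real.exp t / c₁ * ∑ i, D.σ i t) := by
  obtain ⟨t, ht, hS⟩ := D.exists_good_slice hc₁ hA0 ha hε hosc hF
  have htT : t < T₀ := ht.2.trans_lt ha
  refine ⟨t, ht, ?_⟩
  have h1 := D.abs_H_sub_Q_le hc₁ htT
  have h2 := D.sum_Fm_le htT (hF t ht)
  set b := ∑ i, ∑ j, |A⁻¹ i j| with hb
  have hb0 : 0 ≤ b := Finset.sum_nonneg fun i _ => Finset.sum_nonneg fun j _ => abs_nonneg _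
  have h5 := mul_le_mul_of_nonneg_left hS hb0
  set α := (n + 1) * (2 + ∑ i, ∑ j, A i j) with hα
  set Q₀ := 2 * μ ^ 2 * ∑ i, ∑ j, A⁻¹ i j with hQ₀
  have hQ := D.Q_eq hA hsymm t
  set P := (∑ i, ∑ j, A i j * D.σ i t * D.σ j t) - 4 * μ * ∑ i, D.σ i t with hP
  have hκ : 0 ≤ c₃ * Real.exp t / c₁ := by positivity
  have key : |D.H t - Q₀| ≤ c₃ * Real.exp t / c₁ * ∑ i, D.σ i t := by
    have hlim : Tendsto (fun ε' : ℝ => c₃ * Real.exp t / c₁ * (∑ i, D.σ i t) +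
        (b * (α * ε' ^ 2) + n * ε' + ε')) (nhdsWithin 0 (Set.Ioi 0))
        (nhds (c₃ * Real.exp t / c₁ * (∑ i, D.σ i t) + (b * (α * 0 ^ 2) + n * 0 + 0))) := by
      refine Tendsto.mono_left (Continuous.tendsto ?_ 0) nhdsWithin_le_nhds
      fun_prop
    have hlim' := ge_of_tendsto hlim (b := |D.H t - Q₀|) ?_
    · simpa using hlim'
    · filter_upwards [self_mem_nhdsWithin] with ε' hε'
      obtain ⟨s, hs, hs'⟩ := D.exists_H_near hc₁ hμ hA0 (T := t) (ε := ε') hε'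
      have h6 := D.abs_H_sub_H_le hA hsymm hc₁ hc₃ hs.le htT
      have h7 : ∑ i, (D.σ i t - D.σ i s) ≤ ∑ i, D.σ i t := Finset.sum_le_sum fun i _ => by
        linarith [D.σ_nonneg hA hc₁ hA0 i (hs.trans htT)]
      have h8 := mul_le_mul_of_nonneg_left h7 hκ
      have h9 := abs_sub_le (D.H t) (D.H s) Q₀
      linarith
  have h10 := abs_sub_le (D.Q t) (D.H t) Q₀
  rw [abs_sub_comm (D.Q t) (D.H t)] at h10
  have h11 : D.Q t - Q₀ = 1 / 2 * P := by rw [hQ]; ring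
  rw [h11, abs_mul, abs_of_pos (by norm_num : (0:ℝ) < 1 / 2)] at h10
  linarith

end CylinderSolution

lemma mul_sub_le_of_le_hasDerivAt {f f' : ℝ → ℝ} {a b c : ℝ} (hab : a ≤ b)
    (hd : ∀ t ∈ Set.Icc a b, HasDerivAt f (f' t) t) (hc : ∀ t ∈ Set.Icc a b, c ≤ f' t) :
    c * (b - a) ≤ f b - f a := by
  have h := monotoneOn_of_hasDerivWithinAt_nonneg (f := fun t => f t - c * t)
    (f' := fun t => f' t - c) (convex_Icc a b)
    (fun r hr => ((hd r hr).continuousAt.sub (by fun_prop)).continuousWithinAt)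
    (fun r hr => ((hd r (interior_subset hr)).sub (by
      simpa using (hasDerivAt_id r).const_mul c)).hasDerivWithinAt)
    (fun r hr => sub_nonneg.mpr (hc r (interior_subset hr))) ⟨le_rfl, hab⟩ ⟨hab, le_rfl⟩ hab
  linarith

lemma sub_le_of_hasDerivAt_le {f f' : ℝ → ℝ} {a b c : ℝ} (hab : a ≤ b)
    (hd : ∀ t ∈ Set.Icc a b, HasDerivAt f (f' t) t) (hc : ∀ t ∈ Set.Icc a b, f' t ≤ c) :
    f b - f a ≤ c * (b - a) := by
  have h := mul_sub_le_of_le_hasDerivAt (f := fun t => -f t) (c := -c) hab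
    (fun t ht => (hd t ht).neg) fun t ht => neg_le_neg (hc t ht)
  linarith

namespace CylinderSolution

variable {n : ℕ} {A : Matrix (Fin n) (Fin n) ℝ} {μ T₀ c₁ c₂ c₃ C : ℝ}

section single

variable (D : CylinderSolution A μ T₀ c₁ c₂ c₃ C)

lemma sum_mul_le (hA0 : ∀ i j, 0 ≤ A i j) (i : Fin n) {x : Fin n → ℝ} {y : ℝ} (hy : 0 ≤ y)
    (hx : ∀ j, x j ≤ y) : ∑ j, A i j * x j ≤ (∑ i, ∑ j, A i j) * y := by
  calc ∑ j, A i j * x j ≤ ∑ j, A i j * y :=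
        Finset.sum_le_sum fun j _ => mul_le_mul_of_nonneg_left (hx j) (hA0 i j)
    _ = (∑ j, A i j) * y := by rw [Finset.sum_mul]
    _ ≤ _ := mul_le_mul_of_nonneg_right (Finset.single_le_sum (f := fun i => ∑ j, A i j)
        (fun i _ => Finset.sum_nonneg fun j _ => hA0 i j) (Finset.mem_univ i)) hy

lemma φt_le (hA : IsUnit A.det) (hc₁ : 0 < c₁) (hA0 : ∀ i j, 0 ≤ A i j) (i : Fin n) {t : ℝ}
    (ht : t < T₀) : D.φt i t ≤ 2 * μ := by
  have h := D.sum_mul_σ hA i t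
  have : 0 ≤ ∑ j, A i j * D.σ j t := Finset.sum_nonneg fun j _ =>
    mul_nonneg (hA0 i j) (D.σ_nonneg hA hc₁ hA0 j ht)
  linarith

lemma φ_le (hA : IsUnit A.det) (hc₁ : 0 < c₁) (hA0 : ∀ i j, 0 ≤ A i j) (i : Fin n) {t : ℝ}
    (ht : t < T₀) : D.φ i t ≤ 2 * μ * t + D.u₀ i := by
  have h := le_of_tendsto_atBot_of_deriv_nonpos (f := fun t => D.φ i t - 2 * μ * t)
    (f' := fun t => D.φt i t - 2 * μ) (T₀ := T₀)
    (fun t ht => (D.hasDerivAt_φ i ht).sub (by simpa using (hasDerivAt_id t).const_mul (2 * μ)))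
    (fun t ht => by linarith [D.φt_le hA hc₁ hA0 i ht]) (D.tendsto_φ_sub i) ht
  linarith

lemma Fm_le_exp_φ (hc₁ : 0 < c₁) (hA0 : ∀ i j, 0 ≤ A i j) (i : Fin n) {t : ℝ} (ht : t < T₀) :
    D.Fm i t ≤ c₂ * Real.exp (oscBound A c₂ C) * Real.exp (D.φ i t) :=
  circleMean_le (D.continuous_F i ht) (D.F_le_exp_φ hc₁ hA0 i ht)

lemma Fm_le_exp (hA : IsUnit A.det) (hc₁ : 0 < c₁) (hA0 : ∀ i j, 0 ≤ A i j) {N : ℝ}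
    (hN : ∀ i, D.u₀ i ≤ N) (i : Fin n) {t : ℝ} (ht : t < T₀) :
    D.Fm i t ≤ c₂ * Real.exp (oscBound A c₂ C) * Real.exp (2 * μ * t + N) := by
  have := D.c₂_pos hc₁ i
  refine (D.Fm_le_exp_φ hc₁ hA0 i ht).trans (mul_le_mul_of_nonneg_left
    (Real.exp_le_exp.mpr ?_) (by positivity))
  linarith [D.φ_le hA hc₁ hA0 i ht, hN i]

lemma hasDerivAt_exp_affine {μ N : ℝ} (hμ : 0 < μ) (c t : ℝ) :
    HasDerivAt (fun t => c / (2 * μ) * Real.exp (2 * μ * t + N))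
      (c * Real.exp (2 * μ * t + N)) t := by
  have h : HasDerivAt (fun t : ℝ => 2 * μ * t + N) (2 * μ) t := by
    simpa using ((hasDerivAt_id t).const_mul (2 * μ)).add_const N
  refine (h.exp.const_mul (c / (2 * μ))).congr_deriv ?_
  field_simp

lemma tendsto_exp_affine {μ N : ℝ} (hμ : 0 < μ) (c : ℝ) :
    Tendsto (fun t => c * Real.exp (2 * μ * t + N)) atBot (nhds 0) := by
  have h : Tendsto (fun t => c * Real.exp (2 * μ * t + N)) atBot (nhds (c * 0)) :=
    (Real.tendsto_exp_atBot.comp (tendsto_atBot_add_const_right _ _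
      (tendsto_id.const_mul_atBot (by positivity)))).const_mul _
  simpa using h

lemma σ_le_exp (hA : IsUnit A.det) (hc₁ : 0 < c₁) (hμ : 0 < μ) (hA0 : ∀ i j, 0 ≤ A i j) {N : ℝ}
    (hN : ∀ i, D.u₀ i ≤ N) (i : Fin n) {t : ℝ} (ht : t < T₀) :
    D.σ i t ≤ c₂ * Real.exp (oscBound A c₂ C) / (2 * μ) * Real.exp (2 * μ * t + N) := by
  set b := c₂ * Real.exp (oscBound A c₂ C) with hb
  have h := le_of_tendsto_atBot_of_deriv_nonpos
    (f := fun t => D.σ i t - b / (2 * μ) * Real.exp (2 * μ * t + N))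
    (f' := fun t => D.Fm i t - b * Real.exp (2 * μ * t + N)) (T₀ := T₀) (l := 0 - 0)
    (fun t ht => (D.hasDerivAt_σ hA i ht).sub (hasDerivAt_exp_affine hμ b t))
    (fun t ht => by linarith [D.Fm_le_exp hA hc₁ hA0 hN i ht])
    ((D.tendsto_σ hc₁ hA0 i).sub (tendsto_exp_affine hμ _)) ht
  linarith

lemma le_φ (hA : IsUnit A.det) (hc₁ : 0 < c₁) (hμ : 0 < μ) (hA0 : ∀ i j, 0 ≤ A i j) {N : ℝ}
    (hN : ∀ i, D.u₀ i ≤ N) (i : Fin n) {t : ℝ} (ht : t < T₀) :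
    2 * μ * t + D.u₀ i - (∑ i, ∑ j, A i j) * (c₂ * Real.exp (oscBound A c₂ C) / (2 * μ)) /
      (2 * μ) * Real.exp (2 * μ * t + N) ≤ D.φ i t := by
  have hc₂ := D.c₂_pos hc₁ i
  set b := c₂ * Real.exp (oscBound A c₂ C) with hb
  set a := ∑ i, ∑ j, A i j with ha
  have hlim := (D.tendsto_φ_sub i).neg.sub
    (tendsto_exp_affine (N := N) hμ (a * (b / (2 * μ)) / (2 * μ)))
  have h := le_of_tendsto_atBot_of_deriv_nonpos
    (f := fun t => -(D.φ i t - 2 * μ * t) - a * (b / (2 * μ)) / (2 * μ) *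
      Real.exp (2 * μ * t + N))
    (f' := fun t => -(D.φt i t - 2 * μ) - a * (b / (2 * μ)) * Real.exp (2 * μ * t + N))
    (T₀ := T₀)
    (fun t ht => ((D.hasDerivAt_φ i ht).sub
      (by simpa using (hasDerivAt_id t).const_mul (2 * μ))).neg.sub
      (hasDerivAt_exp_affine hμ _ t))
    (fun t ht => by
      have h1 := D.sum_mul_σ hA i t
      have h2 := sum_mul_le hA0 i (x := fun j => D.σ j t)
        (y := b / (2 * μ) * Real.exp (2 * μ * t + N)) (by positivity)
        fun j => D.σ_le_exp hA hc₁ hμ hA0 hN j ht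
      linarith) hlim ht
  linarith

/-- A component attaining the maximal height carries a definite amount of mass. -/
lemma exists_le_σ (hA : IsUnit A.det) (hc₁ : 0 < c₁) (hμ : 0 < μ) (hA0 : ∀ i j, 0 ≤ A i j)
    {N : ℝ} (hN : ∀ i, D.u₀ i ≤ N) {i : Fin n} (hi : N ≤ D.u₀ i) (hs : -N / (2 * μ) < T₀) :
    c₁ * Real.exp (-oscBound A c₂ C) * Real.exp (-(2 * μ) - (∑ i, ∑ j, A i j) *
      (c₂ * Real.exp (oscBound A c₂ C) / (2 * μ)) / (2 * μ)) ≤ D.σ i (-N / (2 * μ)) := by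
  have hc₂ := D.c₂_pos hc₁ i
  set b := c₂ * Real.exp (oscBound A c₂ C) with hb
  set a := ∑ i, ∑ j, A i j with ha
  set s := -N / (2 * μ) with hs'
  have ha0 : 0 ≤ a := sum_sum_nonneg hA0
  have hsN : 2 * μ * s + N = 0 := by rw [hs']; field_simp; ring
  have hlt : ∀ t ∈ Set.Icc (s - 1) s, t < T₀ := fun t ht => ht.2.trans_lt hs
  have h := mul_sub_le_of_le_hasDerivAt (by linarith : s - 1 ≤ s)
    (fun t ht => D.hasDerivAt_σ hA i (hlt t ht))
    (c := c₁ * Real.exp (-oscBound A c₂ C) * Real.exp (-(2 * μ) - a * (b / (2 * μ)) / (2 * μ)))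
    fun t ht => ?_
  · linarith [D.σ_nonneg hA hc₁ hA0 i (t := s - 1) (by linarith)]
  · refine le_trans (mul_le_mul_of_nonneg_left (Real.exp_le_exp.mpr ?_) (by positivity))
      (D.exp_φ_le_Fm hc₁ hA0 i (hlt t ht))
    have h1 := D.le_φ hA hc₁ hμ hA0 hN i (hlt t ht)
    have h2 : 2 * μ * t ≤ 2 * μ * s := mul_le_mul_of_nonneg_left ht.2 (by positivity)
    have h3 : 2 * μ * (s - 1) ≤ 2 * μ * t := mul_le_mul_of_nonneg_left ht.1 (by positivity)
    have h4 : Real.exp (2 * μ * t + N) ≤ 1 := Real.exp_le_one_iff.mpr (by linarith)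
    have h5 : a * (b / (2 * μ)) / (2 * μ) * Real.exp (2 * μ * t + N) ≤
      a * (b / (2 * μ)) / (2 * μ) * 1 := mul_le_mul_of_nonneg_left h4 (by positivity)
    linarith

lemma φt_le_of_le_φ (hA : IsUnit A.det) (hc₁ : 0 < c₁) (hA0 : ∀ i j, 0 ≤ A i j) {E : ℝ}
    (hE : ∀ i, ∀ t < T₀, D.σ i t ≤ E) (i : Fin n) {t B L : ℝ} (hL : 0 < L) (ht : t + L < T₀)
    (hB : -B ≤ D.φ i t)
    (hLE : E < c₁ * Real.exp (-oscBound A c₂ C) * Real.exp (-B - 1) * L) :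
    D.φt i (t + L) ≤ -1 / L := by
  by_contra! hcon
  have hlt : ∀ r ∈ Set.Icc t (t + L), r < T₀ := fun r hr => hr.2.trans_lt ht
  have hφt : ∀ r ∈ Set.Icc t (t + L), -1 / L ≤ D.φt i r := fun r hr =>
    hcon.le.trans (D.φt_anti hc₁ hA0 i (hlt r hr) ht hr.2)
  have hφ : ∀ r ∈ Set.Icc t (t + L), -B - 1 ≤ D.φ i r := by
    intro r hr
    have h := mul_sub_le_of_le_hasDerivAt hr.1
      (fun r' hr' => D.hasDerivAt_φ i (hlt r' ⟨hr'.1, hr'.2.trans hr.2⟩))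
      (fun r' hr' => hφt r' ⟨hr'.1, hr'.2.trans hr.2⟩)
    have h1 : -1 / L * L ≤ -1 / L * (r - t) :=
      mul_le_mul_of_nonpos_left (by linarith [hr.2])
        (div_nonpos_of_nonpos_of_nonneg (by norm_num) hL.le)
    rw [div_mul_cancel₀ _ hL.ne'] at h1
    linarith
  have h := mul_sub_le_of_le_hasDerivAt (by linarith : t ≤ t + L)
    (fun r hr => D.hasDerivAt_σ hA i (hlt r hr))
    (c := c₁ * Real.exp (-oscBound A c₂ C) * Real.exp (-B - 1)) fun r hr =>
      le_trans (mul_le_mul_of_nonneg_left (Real.exp_le_exp.mpr (hφ r hr)) (by positivity))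
        (D.exp_φ_le_Fm hc₁ hA0 i (hlt r hr))
  rw [add_sub_cancel_left] at h
  linarith [D.σ_nonneg hA hc₁ hA0 i (t := t) (by linarith), hE i _ ht]

end single

/-- Once a component carries mass, its mean slope becomes uniformly negative shortly after. -/
lemma exists_φt_le (D₀ : CylinderSolution A μ T₀ c₁ c₂ c₃ C)
    (hA : IsUnit A.det) (hc₁ : 0 < c₁) (hμ : 0 < μ) (hA0 : ∀ i j, 0 ≤ A i j)
    (E τ : ℝ) {ζ : ℝ} (hζ : 0 < ζ) (i : Fin n) :
    ∃ L > 0, ∀ (D : CylinderSolution A μ T₀ c₁ c₂ c₃ C) (N : ℝ), (∀ i, D.u₀ i ≤ N) →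
      (∀ i, ∀ t < T₀, D.σ i t ≤ E) → -N / (2 * μ) + τ + L < T₀ →
      ζ ≤ D.σ i (-N / (2 * μ) + τ) → D.φt i (-N / (2 * μ) + τ + L) ≤ -1 / L := by
  have hc₂ := D₀.c₂_pos hc₁ i
  set b := c₂ * Real.exp (oscBound A c₂ C) with hb
  have hb0 : 0 < b := by positivity
  obtain ⟨R, hR, hRτ⟩ : ∃ R, b / (2 * μ) * Real.exp (2 * μ * (-R) + 0) < ζ / 2 ∧ -R < τ := by
    have h1 := ((tendsto_exp_affine (N := 0) hμ (b / (2 * μ))).comp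
      tendsto_neg_atTop_atBot).eventually_lt_const (half_pos hζ)
    have h2 : ∀ᶠ R : ℝ in atTop, -R < τ := by
      filter_upwards [eventually_gt_atTop (-τ)] with R hR
      linarith
    exact (h1.and h2).exists
  obtain ⟨B, hB⟩ : ∃ B : ℝ, b * Real.exp (-B) * (τ + R) < ζ / 2 := by
    have h1 : Tendsto (fun B : ℝ => b * Real.exp (-B) * (τ + R)) atTop
        (nhds (b * 0 * (τ + R))) :=
      ((Real.tendsto_exp_atBot.comp tendsto_neg_atTop_atBot).const_mul b).mul_const _
    rw [mul_zero, zero_mul] at h1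
    exact (h1.eventually_lt_const (half_pos hζ)).exists
  set α := c₁ * Real.exp (-oscBound A c₂ C) * Real.exp (-B - 1) with hα
  have hα0 : 0 < α := by positivity
  refine ⟨(|E| + 1) / α, by positivity, fun D N hN hE hT hσ => ?_⟩
  set L := (|E| + 1) / α with hL
  have hL0 : 0 < L := by positivity
  set s := -N / (2 * μ) with hs
  have hsN : 2 * μ * s + N = 0 := by rw [hs]; field_simp; ring
  have hlt : ∀ t ∈ Set.Icc (s - R) (s + τ), t < T₀ := fun t ht => by linarith [ht.2]
  have hex : ∃ t ∈ Set.Icc (s - R) (s + τ), -B ≤ D.φ i t := by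
    by_contra! hcon
    have h := sub_le_of_hasDerivAt_le (by linarith : s - R ≤ s + τ)
      (fun t ht => D.hasDerivAt_σ hA i (hlt t ht)) (c := b * Real.exp (-B)) fun t ht =>
        (D.Fm_le_exp_φ hc₁ hA0 i (hlt t ht)).trans (mul_le_mul_of_nonneg_left
          (Real.exp_le_exp.mpr (hcon t ht).le) hb0.le)
    have h1 := D.σ_le_exp hA hc₁ hμ hA0 hN i (t := s - R) (by linarith)
    rw [show 2 * μ * (s - R) + N = 2 * μ * (-R) + 0 by linarith] at h1
    have h2 : s + τ - (s - R) = τ + R := by ring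
    rw [h2] at h
    linarith
  obtain ⟨t, ht, htB⟩ := hex
  have h := D.φt_le_of_le_φ hA hc₁ hA0 hE i hL0 (by linarith [ht.2]) htB (by
    rw [← hα, hL, mul_div_cancel₀ _ hα0.ne']
    linarith [le_abs_self E])
  exact (D.φt_anti hc₁ hA0 i (show t + L < T₀ by linarith [ht.2]) hT
    (by linarith [ht.2])).trans h

end CylinderSolution

lemma apply_eq_zero_of_inv_apply_eq_zero {n : ℕ} {A : Matrix (Fin n) (Fin n) ℝ}
    (hA : IsUnit A.det) (hsymm : A.IsSymm) {T : Finset (Fin n)}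
    (hT : ∀ i ∈ T, ∀ j ∈ Tᶜ, A⁻¹ i j = 0) : ∀ i ∈ T, ∀ j ∈ Tᶜ, A i j = 0 := by
  have hsymm' : ∀ i j, A⁻¹ i j = A⁻¹ j i := fun i j => hsymm.inv.apply j i
  set P : Matrix (Fin n) (Fin n) ℝ := Matrix.diagonal fun i => if i ∈ T then 1 else 0 with hP
  have hcomm : P * A⁻¹ = A⁻¹ * P := by
    ext i j
    rw [hP, Matrix.diagonal_mul, Matrix.mul_diagonal]
    by_cases hi : i ∈ T <;> by_cases hj : j ∈ T
    · simp [hi, hj]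
    · simp [hi, hj, hT i hi j (Finset.mem_compl.mpr hj)]
    · simp [hi, hj, hsymm' i j, hT j hj i (Finset.mem_compl.mpr hi)]
    · simp [hi, hj]
  have hcomm' : P * A = A * P := by
    calc P * A = A * A⁻¹ * P * A := by rw [Matrix.mul_nonsing_inv _ hA, one_mul]
      _ = A * (A⁻¹ * P) * A := by simp only [mul_assoc]
      _ = A * P * (A⁻¹ * A) := by rw [← hcomm]; simp only [mul_assoc]
      _ = A * P := by rw [Matrix.nonsing_inv_mul _ hA, mul_one]
  intro i hi j hj
  have h := congrFun (congrFun hcomm' i) j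
  rw [hP, Matrix.diagonal_mul, Matrix.mul_diagonal] at h
  simpa [hi, Finset.mem_compl.mp hj] using h

/-- Under (H1) and (H2), if every component with positive mass has negative slope at infinity,
then all components do. -/
lemma lt_sum_of_lt_sum_of_pos {n : ℕ} {A : Matrix (Fin n) (Fin n) ℝ} (h1 : H1 A) (h2 : H2 A)
    {c : ℝ} {z : Fin n → ℝ} (hz0 : ∀ i, 0 ≤ z i)
    (hz : ∀ i, 0 < z i → c < ∑ j, A i j * z j) (hpos : ∃ i, 0 < z i) (i : Fin n) :
    c < ∑ j, A i j * z j := by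
  obtain ⟨hsymm, hA0, hirr, hA⟩ := h1
  obtain ⟨-, hoff, hrow⟩ := h2
  set m : Fin n → ℝ := A.mulVec z with hm
  have hzm : ∀ i, z i = ∑ j, A⁻¹ i j * m j := fun i => by
    have : A⁻¹.mulVec m = z := by
      rw [hm, Matrix.mulVec_mulVec, Matrix.nonsing_inv_mul _ hA, Matrix.one_mulVec]
    exact (congrFun this i).symm
  have hm0 : ∀ i, 0 ≤ m i := fun i =>
    show 0 ≤ ∑ j, A i j * z j from Finset.sum_nonneg fun j _ => mul_nonneg (hA0 i j) (hz0 j)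
  obtain ⟨l, -, hl⟩ := Finset.exists_min_image Finset.univ m ⟨i, Finset.mem_univ i⟩
  have hl' : ∀ j, m l ≤ m j := fun j => hl j (Finset.mem_univ j)
  change c < m i
  by_cases hex : ∃ j, m j = m l ∧ 0 < z j
  · obtain ⟨j, hj, hzj⟩ := hex
    exact (hz j hzj).trans_le (hj.le.trans (hl' i))
  · exfalso
    push Not at hex
    set T : Finset (Fin n) := Finset.univ.filter fun j => m j = m l with hT
    have hzT : ∀ j ∈ T, z j = 0 := fun j hj =>
      le_antisymm (hex j (Finset.mem_filter.mp hj).2) (hz0 j)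
    have hinv : ∀ p ∈ T, ∀ q ∈ Tᶜ, A⁻¹ p q = 0 := by
      intro p hp q hq
      have hp' := (Finset.mem_filter.mp hp).2
      have hq' : m q ≠ m l := fun h => Finset.mem_compl.mp hq (by simp [hT, h])
      have hterm : ∀ j ∈ Finset.univ, 0 ≤ A⁻¹ p j * (m j - m l) := by
        intro j _
        by_cases hj : p = j
        · rw [← hj, hp', sub_self, mul_zero]
        · exact mul_nonneg (hoff p j hj) (sub_nonneg.mpr (hl' j))
      have hsum : ∑ j, A⁻¹ p j * (m j - m l) = -(m l * ∑ j, A⁻¹ p j) := by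
        simp only [mul_sub, Finset.sum_sub_distrib, ← Finset.sum_mul]
        rw [← hzm p, hzT p hp]; ring
      have h0 : ∑ j, A⁻¹ p j * (m j - m l) = 0 := le_antisymm
        (by rw [hsum]; exact neg_nonpos.mpr (mul_nonneg (hm0 l) (hrow p)))
        (Finset.sum_nonneg hterm)
      have := (Finset.sum_eq_zero_iff_of_nonneg hterm).mp h0 q (Finset.mem_univ q)
      exact (mul_eq_zero.mp this).resolve_right (sub_ne_zero.mpr hq')
    refine hirr ⟨T, ⟨l, by simp [hT]⟩, ?_, apply_eq_zero_of_inv_apply_eq_zero hA hsymm hinv⟩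
    obtain ⟨j, hj⟩ := hpos
    exact ⟨j, Finset.mem_compl.mpr fun h => hj.ne' (hzT j h)⟩

namespace CylinderSolution

variable {n : ℕ} {A : Matrix (Fin n) (Fin n) ℝ} {μ T₀ c₁ c₂ c₃ C : ℝ}

lemma F_le_of_φt_le (D : CylinderSolution A μ T₀ c₁ c₂ c₃ C) (hA : IsUnit A.det)
    (hc₁ : 0 < c₁) (hA0 : ∀ i j, 0 ≤ A i j) {N s c : ℝ} (hs : s < T₀) (i : Fin n)
    (hN : D.u₀ i ≤ N) (hc : D.φt i s ≤ -c) {t : ℝ} (hst : s ≤ t) (ht : t < T₀) (q : ℝ) :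
    D.F i t q ≤ c₂ * Real.exp (oscBound A c₂ C) * Real.exp (2 * μ * s + N - c * (t - s)) := by
  have hc₂ := D.c₂_pos hc₁ i
  refine (D.F_le_exp_φ hc₁ hA0 i ht q).trans (mul_le_mul_of_nonneg_left
    (Real.exp_le_exp.mpr ?_) (by positivity))
  have h := sub_le_of_hasDerivAt_le hst (fun r hr => D.hasDerivAt_φ i (hr.2.trans_lt ht))
    (c := -c) fun r hr => (D.φt_anti hc₁ hA0 i hs (hr.2.trans_lt ht) hr.1).trans hc
  linarith [D.φ_le hA hc₁ hA0 i hs]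

section sequence

variable (D : ℕ → CylinderSolution A μ T₀ c₁ c₂ c₃ C)

/-- Along a blowup sequence the nonlinearities decay away from the blowup point. -/
lemma frequently_F_le (h1 : H1 A) (h2 : H2 A) (hc₁ : 0 < c₁) (hμ : 0 < μ) {N : ℕ → ℝ}
    (hN : ∀ k i, (D k).u₀ i ≤ N k) (hN' : ∀ k, ∃ i, N k ≤ (D k).u₀ i)
    (hNtop : Tendsto N atTop atTop) {E : ℝ} (hE : ∀ k i, ∀ t < T₀, (D k).σ i t ≤ E)
    (T : ℝ) {η : ℝ} (hη : 0 < η) :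
    ∃ᶠ k in atTop, ∀ t, T ≤ t → t < T₀ → ∀ i q, (D k).F i t q ≤ η := by
  obtain ⟨hsymm, hA0, hirr, hA⟩ := id h1
  have hNbot : Tendsto (fun k => -N k / (2 * μ)) atTop atBot :=
    (tendsto_neg_atTop_atBot.comp hNtop).atBot_div_const (by positivity)
  set s : ℕ → ℝ := fun k => -N k / (2 * μ) with hs
  set l : Ultrafilter ℕ := Ultrafilter.of atTop with hl
  have hlle : (l : Filter ℕ) ≤ atTop := Ultrafilter.of_le _
  have hslt : ∀ τ X, ∀ᶠ k in (l : Filter ℕ), s k + τ < X := fun τ X =>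
    hlle ((tendsto_atBot_add_const_right _ τ hNbot).eventually_lt_atBot X)
  have hlim : ∀ τ j, ∃ Z ∈ Set.Icc 0 E, Tendsto (fun k => (D k).σ j (s k + τ)) l (nhds Z) := by
    intro τ j
    have hmem : ∀ᶠ k in (l : Filter ℕ), (D k).σ j (s k + τ) ∈ Set.Icc 0 E := by
      filter_upwards [hslt τ T₀] with k hk
      exact ⟨(D k).σ_nonneg hA hc₁ hA0 j hk, hE k j _ hk⟩
    exact isCompact_Icc.ultrafilter_le_nhds (l.map fun k => (D k).σ j (s k + τ))
      (le_principal_iff.mpr hmem)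
  choose Z hZ hZlim using hlim
  have hZmono : ∀ j, Monotone fun τ => Z τ j := by
    intro j τ τ' hτ
    refine le_of_tendsto_of_tendsto (hZlim τ j) (hZlim τ' j) ?_
    filter_upwards [hslt τ T₀, hslt τ' T₀] with k hk hk'
    exact (D k).σ_mono hA hc₁ j hk hk' (by linarith)
  have hbdd : ∀ j, BddAbove (Set.range fun τ => Z τ j) := fun j =>
    ⟨E, by rintro _ ⟨τ, rfl⟩; exact (hZ τ j).2⟩
  set z : Fin n → ℝ := fun j => ⨆ τ, Z τ j with hz
  have hzlim : ∀ j, Tendsto (fun τ => Z τ j) atTop (nhds (z j)) := fun j =>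
    tendsto_atTop_ciSup (hZmono j) (hbdd j)
  have hZz : ∀ τ j, Z τ j ≤ z j := fun τ j => le_ciSup (hbdd j) τ
  have hz0 : ∀ j, 0 ≤ z j := fun j => (hZ 0 j).1.trans (hZz 0 j)
  have hφtlim : ∀ τ i, Tendsto (fun k => (D k).φt i (s k + τ)) l
      (nhds (2 * μ - ∑ j, A i j * Z τ j)) := by
    intro τ i
    have := (tendsto_finsetSum Finset.univ fun j _ => (hZlim τ j).const_mul (A i j)).const_sub
      (2 * μ)
    refine this.congr fun k => ?_
    rw [(D k).sum_mul_σ hA]; ring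
  have hneg : ∀ i, 0 < z i → 2 * μ < ∑ j, A i j * z j := by
    intro i hi
    obtain ⟨τ, hτ⟩ := ((hzlim i).eventually_const_lt hi).exists
    obtain ⟨L, hL, h⟩ := (D 0).exists_φt_le hA hc₁ hμ hA0 E τ (half_pos hτ) i
    have hle : 2 * μ - ∑ j, A i j * Z (τ + L) j ≤ -1 / L := by
      refine le_of_tendsto (hφtlim (τ + L) i) ?_
      filter_upwards [hslt (τ + L) T₀, (hZlim τ i).eventually_const_lt (half_lt_self hτ)]
        with k hk hk'
      rw [← add_assoc] at hk ⊢
      exact h (D k) (N k) (hN k) (hE k) hk hk'.le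
    have h3 : ∑ j, A i j * Z (τ + L) j ≤ ∑ j, A i j * z j :=
      Finset.sum_le_sum fun j _ => mul_le_mul_of_nonneg_left (hZz _ j) (hA0 i j)
    have h4 : -1 / L < 0 := div_neg_of_neg_of_pos (by norm_num) hL
    linarith
  have hpos : ∃ i, 0 < z i := by
    by_contra! hcon
    have hZ0 : ∀ j, Z 0 j = 0 := fun j => le_antisymm ((hZz 0 j).trans (hcon j)) (hZ 0 j).1
    obtain ⟨i₀, -⟩ := hN' 0
    set ζ := c₁ * Real.exp (-oscBound A c₂ C) * Real.exp (-(2 * μ) - (∑ i, ∑ j, A i j) *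
      (c₂ * Real.exp (oscBound A c₂ C) / (2 * μ)) / (2 * μ)) with hζ
    have hζ0 : 0 < ζ := by positivity
    have hsum : Tendsto (fun k => ∑ j, (D k).σ j (s k + 0)) l (nhds (∑ j, Z 0 j)) :=
      tendsto_finsetSum _ fun j _ => hZlim 0 j
    have hge : ζ ≤ ∑ j, Z 0 j := by
      refine ge_of_tendsto hsum ?_
      filter_upwards [hslt 0 T₀] with k hk
      obtain ⟨i, hi⟩ := hN' k
      have hk' := hk
      rw [add_zero] at hk'
      have h := (D k).exists_le_σ hA hc₁ hμ hA0 (hN k) hi hk'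
      rw [add_zero]
      exact h.trans (Finset.single_le_sum (f := fun j => (D k).σ j (s k))
        (fun j _ => (D k).σ_nonneg hA hc₁ hA0 j hk') (Finset.mem_univ i))
    simp only [hZ0, Finset.sum_const_zero] at hge
    linarith
  have hall := lt_sum_of_lt_sum_of_pos h1 h2 hz0 hneg hpos
  obtain ⟨τ, hτ⟩ : ∃ τ, ∀ i, 2 * μ < ∑ j, A i j * Z τ j :=
    (eventually_all.mpr fun i => (tendsto_finsetSum Finset.univ fun j _ =>
      (hzlim j).const_mul (A i j)).eventually_const_lt (hall i)).exists
  obtain ⟨c, hc0, hc⟩ : ∃ c > 0, ∀ i, c < ∑ j, A i j * Z τ j - 2 * μ := by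
    have : ∀ᶠ c in nhdsWithin (0 : ℝ) (Set.Ioi 0), ∀ i, c < ∑ j, A i j * Z τ j - 2 * μ :=
      eventually_all.mpr fun i => nhdsWithin_le_nhds
        (eventually_lt_nhds (sub_pos.mpr (hτ i)))
    obtain ⟨c, hc, hc'⟩ := (this.and self_mem_nhdsWithin).exists
    exact ⟨c, hc', hc⟩
  have hev : ∀ᶠ k in (l : Filter ℕ), ∀ i, (D k).φt i (s k + τ) ≤ -c :=
    eventually_all.mpr fun i =>
      ((hφtlim τ i).eventually_lt_const (show _ < -c by linarith [hc i])).mono fun k hk => hk.le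
  have hsmall : Tendsto (fun k => c₂ * Real.exp (oscBound A c₂ C) *
      Real.exp (2 * μ * τ - c * (T - (s k + τ)))) l (nhds 0) := by
    have h3 : Tendsto (fun k => 2 * μ * τ - c * (T - (s k + τ))) l atBot := by
      have h4 : Tendsto (fun k => c * s k + (2 * μ * τ - c * (T - τ))) l atBot :=
        tendsto_atBot_add_const_right _ _ ((hNbot.mono_left hlle).const_mul_atBot hc0)
      exact h4.congr fun k => by ring
    simpa using (Real.tendsto_exp_atBot.comp h3).const_mul
      (c₂ * Real.exp (oscBound A c₂ C))
  have hfin : ∀ᶠ k in (l : Filter ℕ), ∀ t, T ≤ t → t < T₀ → ∀ i q, (D k).F i t q ≤ η := by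
    filter_upwards [hev, hslt τ T₀, hslt τ T, hsmall.eventually_le_const hη]
      with k hk hkT hkT' hkη t htT ht i q
    have hc₂ := (D k).c₂_pos hc₁ i
    have h := (D k).F_le_of_φt_le hA hc₁ hA0 hkT i (hN k i) (hk i) (hkT'.le.trans htT) ht q
    refine h.trans (le_trans (mul_le_mul_of_nonneg_left (Real.exp_le_exp.mpr ?_)
      (by positivity)) hkη)
    have h5 : 2 * μ * s k + N k = 0 := by simp only [hs]; field_simp; ring
    have h6 : c * (T - (s k + τ)) ≤ c * (t - (s k + τ)) :=
      mul_le_mul_of_nonneg_left (by linarith) hc0.le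
    linarith
  exact hfin.frequently.filter_mono hlle

end sequence

end CylinderSolution

namespace CylinderSolution

variable {n : ℕ} {A : Matrix (Fin n) (Fin n) ℝ} {μ T₀ c₁ c₂ c₃ C : ℝ}

lemma le_σ_of_tendsto (D : CylinderSolution A μ T₀ c₁ c₂ c₃ C) (hA : IsUnit A.det)
    (hc₁ : 0 < c₁) {i : Fin n} {e : ℝ} (he : Tendsto (D.σ i) (nhdsWithin T₀ (Set.Iio T₀)) (nhds e))
    {t : ℝ} (ht : t < T₀) : D.σ i t ≤ e := by
  refine ge_of_tendsto he ?_
  filter_upwards [Ioo_mem_nhdsLT ht] with r hr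
  exact D.σ_mono hA hc₁ i ht hr.2 hr.1.le

/-- Approximate Pohozaev identity for the total masses, when the nonlinearity is uniformly small
on a long cylinder adjacent to the boundary. -/
lemma exists_near_abs_pohozaev_le (D : CylinderSolution A μ T₀ c₁ c₂ c₃ C)
    (hA : IsUnit A.det) (hsymm : A.IsSymm) (hc₁ : 0 < c₁) (hμ : 0 < μ) (hc₃ : 0 ≤ c₃)
    (hA0 : ∀ i j, 0 ≤ A i j) (i₀ : Fin n) {e : Fin n → ℝ}
    (he : ∀ i, Tendsto (D.σ i) (nhdsWithin T₀ (Set.Iio T₀)) (nhds (e i))) {l η ε : ℝ} (hl : 2 < l)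
    (hη : 0 < η) (hF : ∀ t, T₀ - 2 * l ≤ t → t < T₀ → ∀ i q, D.F i t q ≤ η)
    (hε : ε = 2 * oscBound A c₂ C * Real.cosh 1 / Real.cosh (l / 2) +
      2 * (((∑ i, ∑ j, A i j) + 1) * η) + η) :
    ∃ x : Fin n → ℝ, (∀ i, |x i - e i| ≤ η * l) ∧
      |(∑ i, ∑ j, A i j * x i * x j) - 4 * μ * ∑ i, x i| ≤
      2 * ((∑ i, ∑ j, |A⁻¹ i j|) * ((n + 1) * (2 + ∑ i, ∑ j, A i j) * ε ^ 2) + n * ε +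
        c₃ * Real.exp (T₀ - l + 2) / c₁ * ∑ i, x i) := by
  have hK := D.oscBound_pos hc₁ hA0 i₀
  have ha0 := sum_sum_nonneg hA0
  set K := oscBound A c₂ C with hKdef
  have hη' : 0 < ((∑ i, ∑ j, A i j) + 1) * η := by positivity
  have hch := Real.cosh_pos (l / 2)
  have hch1 := Real.cosh_pos 1
  have hq0 : 0 < 2 * K * Real.cosh 1 / Real.cosh (l / 2) := by positivity
  have hηε : η ≤ ε := by rw [hε]; linarith
  have hosc : ∀ t ∈ Set.Icc (T₀ - l) (T₀ - l + 2), ∀ i q q', |D.U i t q - D.U i t q'| ≤ ε := by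
    intro t ht i
    have hone : ∀ q q', D.U i t q - D.U i t q' ≤ ε := by
      intro q q'
      have h := D.osc_le_of_ends i (a := T₀ - 2 * l) (b := T₀) (by linarith) le_rfl hK.le hη'
        (D.osc_le hc₁ hA0 i (by linarith)) (D.osc_le hc₁ hA0 i le_rfl)
        (fun r hr p p' => by
          have h1 := D.sum_F_bounds hc₁ hA0 i hr.2 hη.le (hF r hr.1.le hr.2) p
          have h2 := D.sum_F_bounds hc₁ hA0 i hr.2 hη.le (hF r hr.1.le hr.2) p'
          rw [abs_le]
          constructor <;> linarith [h1.1, h1.2, h2.1, h2.2])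
        (t := t) ⟨by linarith [ht.1], by linarith [ht.2]⟩ q q'
      have h3 : Real.cosh ((t - (T₀ - 2 * l + T₀) / 2) / 2) ≤ Real.cosh 1 := by
        rw [Real.cosh_le_cosh, abs_one, abs_le]
        constructor <;> linarith [ht.1, ht.2]
      rw [show (T₀ - (T₀ - 2 * l)) / 4 = l / 2 by ring] at h
      have h4 : 2 * K * Real.cosh ((t - (T₀ - 2 * l + T₀) / 2) / 2) / Real.cosh (l / 2) ≤
          2 * K * Real.cosh 1 / Real.cosh (l / 2) := by gcongr
      linarith
    intro q q'
    rw [abs_le]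
    constructor <;> linarith [hone q q', hone q' q]
  obtain ⟨t, ht, htP⟩ := D.exists_abs_pohozaev_le hA hsymm hc₁ hμ hc₃ hA0 (a := T₀ - l)
    (by linarith) (hη.trans_le hηε) hosc fun t ht i q =>
      (hF t (by linarith [ht.1]) (by linarith [ht.2]) i q).trans hηε
  have htT : t < T₀ := by linarith [ht.2]
  refine ⟨fun i => D.σ i t, fun i => ?_, htP.trans ?_⟩
  · have h1 := D.le_σ_of_tendsto hA hc₁ (he i) htT
    have h2 : e i ≤ D.σ i t + η * l := by
      refine le_of_tendsto (he i) ?_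
      filter_upwards [Ioo_mem_nhdsLT htT] with r hr
      have h3 := sub_le_of_hasDerivAt_le hr.1.le
        (fun p hp => D.hasDerivAt_σ hA i (hp.2.trans_lt hr.2)) (c := η) fun p hp =>
          circleMean_le (D.continuous_F i (hp.2.trans_lt hr.2))
            (hF p (by linarith [ht.1, hp.1]) (hp.2.trans_lt hr.2) i)
      have h4 : η * (r - t) ≤ η * l :=
        mul_le_mul_of_nonneg_left (by linarith [hr.2, ht.1]) hη.le
      linarith
    rw [abs_le]
    constructor <;> linarith
  · have h5 : 0 ≤ ∑ i, D.σ i t := Finset.sum_nonneg fun i _ => D.σ_nonneg hA hc₁ hA0 i htT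
    have h6 : Real.exp t ≤ Real.exp (T₀ - l + 2) := Real.exp_le_exp.mpr ht.2
    gcongr

/-- The Pohozaev identity for the limit masses of a blowup sequence on the half-cylinder. -/
theorem pohozaev_of_tendsto (D : ℕ → CylinderSolution A μ T₀ c₁ c₂ c₃ C)
    (h1 : H1 A) (h2 : H2 A) (hc₁ : 0 < c₁) (hμ : 0 < μ) (hc₃ : 0 ≤ c₃) {N : ℕ → ℝ}
    (hN : ∀ k i, (D k).u₀ i ≤ N k) (hN' : ∀ k, ∃ i, N k ≤ (D k).u₀ i)
    (hNtop : Tendsto N atTop atTop) {e : ℕ → Fin n → ℝ}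
    (he : ∀ k i, Tendsto ((D k).σ i) (nhdsWithin T₀ (Set.Iio T₀)) (nhds (e k i)))
    {σ : Fin n → ℝ} (hσ : ∀ i, Tendsto (fun k => e k i) atTop (nhds (σ i))) :
    ∑ i, ∑ j, A i j * σ i * σ j = 4 * μ * ∑ i, σ i := by
  obtain ⟨hsymm, hA0, hirr, hA⟩ := id h1
  obtain ⟨i₀, -⟩ := hN' 0
  obtain ⟨E, hE⟩ : ∃ E, ∀ i k, e k i ≤ E := by
    choose E hE using fun i => (hσ i).bddAbove_range
    exact ⟨∑ i, |E i|, fun i k => ((hE i ⟨k, rfl⟩).trans (le_abs_self _)).trans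
      (Finset.single_le_sum (f := fun i => |E i|) (fun i _ => abs_nonneg _) (Finset.mem_univ i))⟩
  have hEσ : ∀ k i, ∀ t < T₀, (D k).σ i t ≤ E := fun k i t ht =>
    ((D k).le_σ_of_tendsto hA hc₁ (he k i) ht).trans (hE i k)
  set l : ℕ → ℝ := fun m => m + 3 with hl
  set η : ℕ → ℝ := fun m => 1 / ((m : ℝ) + 3) ^ 2 with hη
  set ε : ℕ → ℝ := fun m => 2 * oscBound A c₂ C * Real.cosh 1 / Real.cosh (l m / 2) +
      2 * (((∑ i, ∑ j, A i j) + 1) * η m) + η m with hε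
  have hη0 : ∀ m, 0 < η m := fun m => by simp only [hη]; positivity
  have hex : ∀ m : ℕ, ∃ k ≥ m, ∀ t, T₀ - 2 * l m ≤ t → t < T₀ → ∀ i q, (D k).F i t q ≤ η m :=
    fun m => frequently_atTop.mp
      (frequently_F_le D h1 h2 hc₁ hμ hN hN' hNtop hEσ (T₀ - 2 * l m) (hη0 m)) m
  choose k hkm hkF using hex
  choose x hx hxP using fun m => (D (k m)).exists_near_abs_pohozaev_le hA hsymm hc₁ hμ hc₃ hA0 i₀
    (he (k m)) (by simp only [hl]; linarith [(Nat.cast_nonneg m : (0:ℝ) ≤ m)]) (hη0 m)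
    (hkF m) (rfl : ε m = _)
  have hk : Tendsto k atTop atTop := tendsto_atTop_mono hkm tendsto_id
  have hltop : Tendsto l atTop atTop :=
    tendsto_atTop_add_const_right _ _ tendsto_natCast_atTop_atTop
  have hlinv : Tendsto (fun m => (l m)⁻¹) atTop (nhds 0) := tendsto_inv_atTop_zero.comp hltop
  have hηlim : Tendsto η atTop (nhds 0) := by
    have h := hlinv.pow 2
    rw [zero_pow two_ne_zero] at h
    exact h.congr fun m => by simp [hη, hl]
  have hηl : Tendsto (fun m => η m * l m) atTop (nhds 0) := by
    refine hlinv.congr fun m => ?_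
    have : (0:ℝ) < (m : ℝ) + 3 := by positivity
    simp only [hη, hl]
    field_simp
  have hcosh : Tendsto (fun m => Real.cosh (l m / 2)) atTop atTop := by
    have h3 : Tendsto (fun m => Real.exp (l m / 2) / 2) atTop atTop :=
      (Real.tendsto_exp_atTop.comp (hltop.atTop_div_const two_pos)).atTop_div_const two_pos
    refine tendsto_atTop_mono (fun m => ?_) h3
    rw [Real.cosh_eq]
    linarith [Real.exp_pos (-(l m / 2))]
  have hεlim : Tendsto ε atTop (nhds 0) := by
    have h3 := ((hcosh.const_div_atTop (2 * oscBound A c₂ C * Real.cosh 1)).add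
      ((hηlim.const_mul ((∑ i, ∑ j, A i j) + 1)).const_mul 2)).add hηlim
    simpa using h3
  have hκlim : Tendsto (fun m => c₃ * Real.exp (T₀ - l m + 2) / c₁) atTop (nhds 0) := by
    have h3 : Tendsto (fun m => T₀ - l m + 2) atTop atBot := by
      have h4 : Tendsto (fun m => -l m + (T₀ + 2)) atTop atBot :=
        tendsto_atBot_add_const_right _ _ (tendsto_neg_atTop_atBot.comp hltop)
      exact h4.congr fun m => by ring
    simpa using ((Real.tendsto_exp_atBot.comp h3).const_mul c₃).div_const c₁
  have hxlim : ∀ i, Tendsto (fun m => x m i) atTop (nhds (σ i)) := by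
    intro i
    have h3 : Tendsto (fun m => x m i - e (k m) i) atTop (nhds 0) :=
      squeeze_zero_norm (fun m => by simpa using hx m i) hηl
    simpa using h3.add ((hσ i).comp hk)
  have hsum : Tendsto (fun m => ∑ i, x m i) atTop (nhds (∑ i, σ i)) :=
    tendsto_finsetSum _ fun i _ => hxlim i
  have hP : Tendsto (fun m => |(∑ i, ∑ j, A i j * x m i * x m j) - 4 * μ * ∑ i, x m i|) atTop
      (nhds |(∑ i, ∑ j, A i j * σ i * σ j) - 4 * μ * ∑ i, σ i|) :=
    ((tendsto_finsetSum _ fun i _ => tendsto_finsetSum _ fun j _ =>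
      ((hxlim i).const_mul _).mul (hxlim j)).sub (hsum.const_mul _)).abs
  have hR := (((((hεlim.pow 2).const_mul (((n : ℝ) + 1) * (2 + ∑ i, ∑ j, A i j))).const_mul
    (∑ i, ∑ j, |A⁻¹ i j|)).add (hεlim.const_mul (n : ℝ))).add (hκlim.mul hsum)).const_mul 2
  have hfin := le_of_tendsto_of_tendsto' hP hR hxP
  simp only [ne_eq, OfNat.ofNat_ne_zero, not_false_eq_true, zero_pow, mul_zero, zero_mul,
    add_zero] at hfin
  exact sub_eq_zero.mp (abs_nonpos_iff.mp hfin)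

end CylinderSolution

/-- Logarithmic polar coordinates on the plane. -/
def logPolar (t q : ℝ) : E2 := !₂[Real.exp t * Real.cos q, Real.exp t * Real.sin q]

/-- The rotation by a right angle of `logPolar t q`. -/
def logPolarRot (t q : ℝ) : E2 := !₂[-(Real.exp t * Real.sin q), Real.exp t * Real.cos q]

lemma hasDerivAt_E2 {f g : ℝ → ℝ} {f' g' t : ℝ} (hf : HasDerivAt f f' t) (hg : HasDerivAt g g' t) :
    HasDerivAt (fun s => (!₂[f s, g s] : E2)) !₂[f', g'] t := by
  have h : HasDerivAt (fun s => ![f s, g s]) ![f', g'] t := by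
    rw [hasDerivAt_pi]
    intro i
    fin_cases i
    · simpa using hf
    · simpa using hg
  exact (PiLp.continuousLinearEquiv 2 ℝ (fun _ : Fin 2 => ℝ)).symm.hasFDerivAt.comp_hasDerivAt t h

lemma hasDerivAt_logPolar_fst (t q : ℝ) :
    HasDerivAt (fun s => logPolar s q) (logPolar t q) t :=
  hasDerivAt_E2 ((Real.hasDerivAt_exp t).mul_const _) ((Real.hasDerivAt_exp t).mul_const _)

lemma hasDerivAt_logPolarRot_fst (t q : ℝ) :
    HasDerivAt (fun s => logPolarRot s q) (logPolarRot t q) t :=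
  hasDerivAt_E2 ((Real.hasDerivAt_exp t).mul_const _).neg ((Real.hasDerivAt_exp t).mul_const _)

lemma hasDerivAt_logPolar_snd (t q : ℝ) :
    HasDerivAt (fun s => logPolar t s) (logPolarRot t q) q := by
  refine hasDerivAt_E2 ?_ ((Real.hasDerivAt_sin q).const_mul _)
  simpa using (Real.hasDerivAt_cos q).const_mul (Real.exp t)

lemma hasDerivAt_logPolarRot_snd (t q : ℝ) :
    HasDerivAt (fun s => logPolarRot t s) (-logPolar t q) q := by
  have h := hasDerivAt_E2 ((Real.hasDerivAt_sin q).const_mul (Real.exp t)).neg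
    ((Real.hasDerivAt_cos q).const_mul (Real.exp t))
  refine h.congr_deriv ?_
  ext i
  fin_cases i <;> simp [logPolar]

lemma continuous_logPolar : Continuous (Function.uncurry logPolar) := by
  unfold logPolar Function.uncurry
  fun_prop

lemma continuous_logPolarRot : Continuous (Function.uncurry logPolarRot) := by
  unfold logPolarRot Function.uncurry
  fun_prop

lemma norm_logPolar (t q : ℝ) : ‖logPolar t q‖ = Real.exp t := by
  rw [EuclideanSpace.norm_eq, Real.sqrt_eq_iff_mul_self_eq_of_pos (Real.exp_pos t)]
  simp only [logPolar, Fin.sum_univ_two, Real.norm_eq_abs, sq_abs]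
  simp only [Matrix.cons_val_zero, Matrix.cons_val_one]
  linear_combination (-(Real.exp t) ^ 2) * Real.sin_sq_add_cos_sq q

lemma logPolar_ne_zero (t q : ℝ) : logPolar t q ≠ 0 := by
  rw [← norm_pos_iff, norm_logPolar]
  exact Real.exp_pos t

lemma logPolar_mem_closedBall {δ t : ℝ} (hδ : 0 < δ) (ht : t ≤ Real.log δ) (q : ℝ) :
    logPolar t q ∈ closedBall (0 : E2) δ := by
  rw [mem_closedBall_zero_iff, norm_logPolar]
  exact (Real.le_log_iff_exp_le hδ).mp ht

lemma logPolar_mem_ball {δ t : ℝ} (hδ : 0 < δ) (ht : t < Real.log δ) (q : ℝ) :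
    logPolar t q ∈ ball (0 : E2) δ := by
  rw [mem_ball_zero_iff, norm_logPolar]
  exact (Real.lt_log_iff_exp_lt hδ).mp ht

lemma logPolar_mem_punctured {δ t : ℝ} (hδ : 0 < δ) (ht : t < Real.log δ) (q : ℝ) :
    logPolar t q ∈ ball (0 : E2) δ \ {0} :=
  ⟨logPolar_mem_ball hδ ht q, logPolar_ne_zero t q⟩

lemma logPolar_periodic (t : ℝ) : Function.Periodic (logPolar t) (2 * Real.pi) := fun q => by
  simp [logPolar]

lemma logPolarRot_periodic (t : ℝ) : Function.Periodic (logPolarRot t) (2 * Real.pi) :=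
  fun q => by simp [logPolarRot]

lemma isOpen_punctured (δ : ℝ) : IsOpen (ball (0 : E2) δ \ {0}) :=
  isOpen_ball.sdiff isClosed_singleton

section derivatives

variable {δ : ℝ} {w : E2 → ℝ}

lemma hasFDerivAt_of_C2 (hw : ContDiffOn ℝ 2 w (ball (0 : E2) δ \ {0})) {x : E2}
    (hx : x ∈ ball (0 : E2) δ \ {0}) : HasFDerivAt w (fderiv ℝ w x) x :=
  ((hw.contDiffAt ((isOpen_punctured δ).mem_nhds hx)).differentiableAt two_ne_zero).hasFDerivAt

lemma contDiffOn_fderiv_of_C2 (hw : ContDiffOn ℝ 2 w (ball (0 : E2) δ \ {0})) :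
    ContDiffOn ℝ 1 (fderiv ℝ w) (ball (0 : E2) δ \ {0}) :=
  hw.fderiv_of_isOpen (isOpen_punctured δ) (by norm_num)

lemma hasFDerivAt_fderiv_of_C2 (hw : ContDiffOn ℝ 2 w (ball (0 : E2) δ \ {0})) {x : E2}
    (hx : x ∈ ball (0 : E2) δ \ {0}) :
    HasFDerivAt (fderiv ℝ w) (fderiv ℝ (fderiv ℝ w) x) x :=
  (((contDiffOn_fderiv_of_C2 hw).contDiffAt
    ((isOpen_punctured δ).mem_nhds hx)).differentiableAt one_ne_zero).hasFDerivAt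

lemma fderiv_fderiv_symm (hw : ContDiffOn ℝ 2 w (ball (0 : E2) δ \ {0})) {x : E2}
    (hx : x ∈ ball (0 : E2) δ \ {0}) (a b : E2) :
    fderiv ℝ (fderiv ℝ w) x a b = fderiv ℝ (fderiv ℝ w) x b a :=
  ((hw.contDiffAt ((isOpen_punctured δ).mem_nhds hx)).isSymmSndFDerivAt (by simp)) a b

lemma lap_eq (hw : ContDiffOn ℝ 2 w (ball (0 : E2) δ \ {0})) {x : E2}
    (hx : x ∈ ball (0 : E2) δ \ {0}) :
    lap w x = ∑ i : Fin 2, fderiv ℝ (fderiv ℝ w) x (EuclideanSpace.single i 1)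
      (EuclideanSpace.single i 1) := by
  refine Finset.sum_congr rfl fun i _ => ?_
  have h := (hasFDerivAt_fderiv_of_C2 hw hx).clm_apply
    (hasFDerivAt_const (EuclideanSpace.single i (1 : ℝ) : E2) x)
  rw [h.fderiv]
  simp

lemma logPolar_eq (t q : ℝ) : logPolar t q =
    (Real.exp t * Real.cos q) • EuclideanSpace.single 0 1 +
      (Real.exp t * Real.sin q) • EuclideanSpace.single 1 1 := by
  ext i
  fin_cases i <;> simp [logPolar]

lemma logPolarRot_eq (t q : ℝ) : logPolarRot t q =
    (-(Real.exp t * Real.sin q)) • EuclideanSpace.single 0 1 +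
      (Real.exp t * Real.cos q) • EuclideanSpace.single 1 1 := by
  ext i
  fin_cases i <;> simp [logPolarRot]

lemma second_derivs_logPolar (B : E2 →L[ℝ] E2 →L[ℝ] ℝ) (t q : ℝ) :
    B (logPolar t q) (logPolar t q) + B (logPolarRot t q) (logPolarRot t q) =
      Real.exp t ^ 2 * ∑ i : Fin 2, B (EuclideanSpace.single i 1) (EuclideanSpace.single i 1) := by
  rw [logPolar_eq, logPolarRot_eq, Fin.sum_univ_two]
  simp only [map_add, map_smul, add_apply, smul_apply,
    smul_eq_mul]
  linear_combination (Real.exp t ^ 2 * (B (EuclideanSpace.single 0 1) (EuclideanSpace.single 0 1) +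
    B (EuclideanSpace.single 1 1) (EuclideanSpace.single 1 1))) * Real.sin_sq_add_cos_sq q

end derivatives

section derivatives

variable {δ : ℝ} {w : E2 → ℝ}

lemma hasDerivAt_comp_logPolar_fst {t q : ℝ}
    (hw : DifferentiableAt ℝ w (logPolar t q)) :
    HasDerivAt (fun s => w (logPolar s q)) (fderiv ℝ w (logPolar t q) (logPolar t q)) t :=
  hw.hasFDerivAt.comp_hasDerivAt t (hasDerivAt_logPolar_fst t q)

lemma hasDerivAt_fderiv_logPolar_fst (hδ : 0 < δ)
    (hw : ContDiffOn ℝ 2 w (ball (0 : E2) δ \ {0})) {t : ℝ} (ht : t < Real.log δ) (q : ℝ)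
    {v : ℝ → E2} {v' : E2} (hv : HasDerivAt v v' t) :
    HasDerivAt (fun s => fderiv ℝ w (logPolar s q) (v s))
      (fderiv ℝ (fderiv ℝ w) (logPolar t q) (logPolar t q) (v t) +
        fderiv ℝ w (logPolar t q) v') t := by
  have h : HasDerivAt (fun s => fderiv ℝ w (logPolar s q))
      (fderiv ℝ (fderiv ℝ w) (logPolar t q) (logPolar t q)) t :=
    HasFDerivAt.comp_hasDerivAt (f := fun s => logPolar s q) t
      (hasFDerivAt_fderiv_of_C2 hw (logPolar_mem_punctured hδ ht q)) (hasDerivAt_logPolar_fst t q)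
  exact h.clm_apply hv

lemma hasDerivAt_fderiv_logPolar_snd (hδ : 0 < δ)
    (hw : ContDiffOn ℝ 2 w (ball (0 : E2) δ \ {0})) {t : ℝ} (ht : t < Real.log δ) (q : ℝ)
    {v : ℝ → E2} {v' : E2} (hv : HasDerivAt v v' q) :
    HasDerivAt (fun s => fderiv ℝ w (logPolar t s) (v s))
      (fderiv ℝ (fderiv ℝ w) (logPolar t q) (logPolarRot t q) (v q) +
        fderiv ℝ w (logPolar t q) v') q := by
  have h : HasDerivAt (fun s => fderiv ℝ w (logPolar t s))
      (fderiv ℝ (fderiv ℝ w) (logPolar t q) (logPolarRot t q)) q :=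
    HasFDerivAt.comp_hasDerivAt (f := fun s => logPolar t s) q
      (hasFDerivAt_fderiv_of_C2 hw (logPolar_mem_punctured hδ ht q)) (hasDerivAt_logPolar_snd t q)
  exact h.clm_apply hv

lemma continuousOn_comp_logPolar (hδ : 0 < δ) {X : Type*} [TopologicalSpace X] {g : E2 → X}
    (hg : ContinuousOn g (ball (0 : E2) δ \ {0})) :
    ContinuousOn (fun p : ℝ × ℝ => g (logPolar p.1 p.2))
      (Set.Iio (Real.log δ) ×ˢ Set.univ) :=
  hg.comp continuous_logPolar.continuousOn fun p hp => logPolar_mem_punctured hδ hp.1 p.2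

lemma continuousOn_fderiv_of_C2 (hw : ContDiffOn ℝ 2 w (ball (0 : E2) δ \ {0})) :
    ContinuousOn (fderiv ℝ w) (ball (0 : E2) δ \ {0}) :=
  (contDiffOn_fderiv_of_C2 hw).continuousOn

lemma continuousOn_fderiv_fderiv_of_C2 (hw : ContDiffOn ℝ 2 w (ball (0 : E2) δ \ {0})) :
    ContinuousOn (fderiv ℝ (fderiv ℝ w)) (ball (0 : E2) δ \ {0}) :=
  (contDiffOn_fderiv_of_C2 hw).continuousOn_fderiv_of_isOpen (isOpen_punctured δ) le_rfl

end derivatives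

namespace LocalBlowupSetup

variable {n : ℕ} {δ γ : ℝ} {A : Matrix (Fin n) (Fin n) ℝ} {h u : ℕ → Fin n → E2 → ℝ} {M : ℕ → ℝ}

lemma differentiableAt_u (S : LocalBlowupSetup n δ γ A h u M) (k : ℕ) (i : Fin n) {t : ℝ}
    (ht : t < Real.log δ) (q : ℝ) : DifferentiableAt ℝ (u k i) (logPolar t q) :=
  (hasFDerivAt_of_C2 (S.u_c2 k i) (logPolar_mem_punctured S.hδ ht q)).differentiableAt

lemma h_c1_ball (S : LocalBlowupSetup n δ γ A h u M) (k : ℕ) (i : Fin n) :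
    ContDiffOn ℝ 1 (h k i) (ball (0 : E2) δ) := (S.h_c1 k i).mono ball_subset_closedBall

lemma c₃_nonneg (S : LocalBlowupSetup n δ γ A h u M) : 0 ≤ S.c₃ :=
  (norm_nonneg _).trans (S.h_grad 0 ⟨0, S.hn⟩ 0 (mem_closedBall_self S.hδ.le))

lemma norm_fderiv_h_le (S : LocalBlowupSetup n δ γ A h u M) (k : ℕ) (i : Fin n) {x : E2}
    (hx : x ∈ ball (0 : E2) δ) : ‖fderiv ℝ (h k i) x‖ ≤ S.c₃ := by
  rw [← fderivWithin_of_mem_nhds (mem_of_superset (isOpen_ball.mem_nhds hx)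
    ball_subset_closedBall)]
  exact S.h_grad k i x (ball_subset_closedBall hx)

lemma exp_mul_rpow (γ t : ℝ) (x : ℝ) :
    Real.exp t ^ 2 * (Real.exp t ^ (2 * γ) * Real.exp x) =
      Real.exp (x + 2 * (1 + γ) * t) := by
  rw [← Real.exp_mul, ← Real.exp_nat_mul, ← Real.exp_add, ← Real.exp_add]
  congr 1
  push_cast
  ring

/-- The blowup sequence in logarithmic polar coordinates. -/
def toCylinder (S : LocalBlowupSetup n δ γ A h u M) {C : ℝ} (hC : S.C ≤ C)
    (hu : ∀ k i, ∀ x ∈ closedBall (0 : E2) δ, x ≠ 0 →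
      u k i x + 2 * (1 + γ) * Real.log ‖x‖ ≤ C) (k : ℕ) :
    CylinderSolution A (1 + γ) (Real.log δ) S.c₁ S.c₂ S.c₃ C where
  U i t q := u k i (logPolar t q) + 2 * (1 + γ) * t
  Ut i t q := fderiv ℝ (u k i) (logPolar t q) (logPolar t q) + 2 * (1 + γ)
  Uq i t q := fderiv ℝ (u k i) (logPolar t q) (logPolarRot t q)
  Utt i t q := fderiv ℝ (fderiv ℝ (u k i)) (logPolar t q) (logPolar t q) (logPolar t q) +
    fderiv ℝ (u k i) (logPolar t q) (logPolar t q)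
  Utq i t q := fderiv ℝ (fderiv ℝ (u k i)) (logPolar t q) (logPolar t q) (logPolarRot t q) +
    fderiv ℝ (u k i) (logPolar t q) (logPolarRot t q)
  Uqq i t q := fderiv ℝ (fderiv ℝ (u k i)) (logPolar t q) (logPolarRot t q) (logPolarRot t q) +
    fderiv ℝ (u k i) (logPolar t q) (-logPolar t q)
  h i t q := h k i (logPolar t q)
  ht i t q := fderiv ℝ (h k i) (logPolar t q) (logPolar t q)
  u₀ i := u k i 0
  dU_t i t ht q := (hasDerivAt_comp_logPolar_fst (S.differentiableAt_u k i ht q)).add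
    (by simpa using (hasDerivAt_id t).const_mul (2 * (1 + γ)))
  dU_q i t ht q := ((S.differentiableAt_u k i ht q).hasFDerivAt.comp_hasDerivAt q
    (hasDerivAt_logPolar_snd t q)).add_const _
  dUt_t i t ht q := (hasDerivAt_fderiv_logPolar_fst S.hδ (S.u_c2 k i) ht q
    (hasDerivAt_logPolar_fst t q)).add_const _
  dUt_q i t ht q := by
    rw [fderiv_fderiv_symm (S.u_c2 k i) (logPolar_mem_punctured S.hδ ht q)]
    exact (hasDerivAt_fderiv_logPolar_snd S.hδ (S.u_c2 k i) ht q
      (hasDerivAt_logPolar_snd t q)).add_const _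
  dUq_t i t ht q := hasDerivAt_fderiv_logPolar_fst S.hδ (S.u_c2 k i) ht q
    (hasDerivAt_logPolarRot_fst t q)
  dUq_q i t ht q := hasDerivAt_fderiv_logPolar_snd S.hδ (S.u_c2 k i) ht q
    (hasDerivAt_logPolarRot_snd t q)
  dh_t i t ht q := hasDerivAt_comp_logPolar_fst
    (((S.h_c1_ball k i).contDiffAt (isOpen_ball.mem_nhds
      (logPolar_mem_ball S.hδ ht q))).differentiableAt one_ne_zero)
  cont_U i := by
    have h1 : ContinuousOn (fun p : ℝ × ℝ => u k i (logPolar p.1 p.2))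
        (Set.Iic (Real.log δ) ×ˢ Set.univ) :=
      (S.u_cont k i).comp continuous_logPolar.continuousOn
        fun p hp => logPolar_mem_closedBall S.hδ hp.1 p.2
    exact h1.add (by fun_prop)
  cont_Ut i := ((continuousOn_comp_logPolar S.hδ (continuousOn_fderiv_of_C2 (S.u_c2 k i))).clm_apply
    continuous_logPolar.continuousOn).add continuousOn_const
  cont_Uq i := (continuousOn_comp_logPolar S.hδ (continuousOn_fderiv_of_C2 (S.u_c2 k i))).clm_apply
    continuous_logPolarRot.continuousOn
  cont_Utt i := (((continuousOn_comp_logPolar S.hδ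
    (continuousOn_fderiv_fderiv_of_C2 (S.u_c2 k i))).clm_apply
    continuous_logPolar.continuousOn).clm_apply continuous_logPolar.continuousOn).add
    ((continuousOn_comp_logPolar S.hδ (continuousOn_fderiv_of_C2 (S.u_c2 k i))).clm_apply
    continuous_logPolar.continuousOn)
  cont_Utq i := (((continuousOn_comp_logPolar S.hδ
    (continuousOn_fderiv_fderiv_of_C2 (S.u_c2 k i))).clm_apply
    continuous_logPolar.continuousOn).clm_apply continuous_logPolarRot.continuousOn).add
    ((continuousOn_comp_logPolar S.hδ (continuousOn_fderiv_of_C2 (S.u_c2 k i))).clm_apply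
    continuous_logPolarRot.continuousOn)
  cont_Uqq i := (((continuousOn_comp_logPolar S.hδ
    (continuousOn_fderiv_fderiv_of_C2 (S.u_c2 k i))).clm_apply
    continuous_logPolarRot.continuousOn).clm_apply continuous_logPolarRot.continuousOn).add
    ((continuousOn_comp_logPolar S.hδ (continuousOn_fderiv_of_C2 (S.u_c2 k i))).clm_apply
    continuous_logPolar.neg.continuousOn)
  cont_h i := continuousOn_comp_logPolar S.hδ
    ((S.h_c1_ball k i).continuousOn.mono Set.sdiff_subset)
  cont_ht i := (continuousOn_comp_logPolar S.hδ
    (((S.h_c1_ball k i).continuousOn_fderiv_of_isOpen isOpen_ball le_rfl).mono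
      Set.sdiff_subset)).clm_apply continuous_logPolar.continuousOn
  per_U i t q := by simp only [logPolar_periodic t q]
  per_Ut i t q := by simp only [logPolar_periodic t q]
  per_Uq i t q := by simp only [logPolar_periodic t q, logPolarRot_periodic t q]
  pde i t ht q := by
    have hx := logPolar_mem_punctured S.hδ ht q
    have h1 := S.pde k i _ hx
    rw [lap_eq (S.u_c2 k i) hx, norm_logPolar] at h1
    have h2 := second_derivs_logPolar (fderiv ℝ (fderiv ℝ (u k i)) (logPolar t q)) t q
    have h3 : ∑ j, A i j * (h k j (logPolar t q) *
        Real.exp (u k j (logPolar t q) + 2 * (1 + γ) * t)) = Real.exp t ^ 2 *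
        ∑ j, A i j * (Real.exp t ^ (2 * γ) * (h k j (logPolar t q) *
          Real.exp (u k j (logPolar t q)))) := by
      rw [Finset.mul_sum]
      refine Finset.sum_congr rfl fun j _ => ?_
      rw [← exp_mul_rpow]
      ring
    rw [h3, map_neg]
    linear_combination h2 + Real.exp t ^ 2 * h1
  h_lb i t ht q := S.h_lb k i _ (logPolar_mem_closedBall S.hδ ht.le q)
  h_ub i t ht q := S.h_ub k i _ (logPolar_mem_closedBall S.hδ ht.le q)
  ht_le i t ht q := by
    have h1 := (fderiv ℝ (h k i) (logPolar t q)).le_of_opNorm_le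
      (S.norm_fderiv_h_le k i (logPolar_mem_ball S.hδ ht q)) (logPolar t q)
    rwa [norm_logPolar, Real.norm_eq_abs] at h1
  U_le i t ht q := by
    have h1 := hu k i _ (logPolar_mem_closedBall S.hδ ht q) (logPolar_ne_zero t q)
    rwa [norm_logPolar, Real.log_exp] at h1
  osc i q q' := by
    have hs : ∀ q, logPolar (Real.log δ) q ∈ sphere (0 : E2) δ := fun q => by
      rw [mem_sphere_zero_iff_norm, norm_logPolar, Real.exp_log S.hδ]
    simpa using (S.osc k i _ (hs q) _ (hs q')).trans hC
  lim i ε hε := by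
    have h1 : ContinuousAt (u k i) 0 :=
      (S.u_cont k i).continuousAt (closedBall_mem_nhds 0 S.hδ)
    obtain ⟨r, hr, h2⟩ := Metric.continuousAt_iff.mp h1 ε hε
    refine ⟨Real.log (r / 2), fun t ht q => ?_⟩
    have h3 : dist (logPolar t q) 0 < r := by
      rw [dist_zero_right, norm_logPolar]
      linarith [(Real.le_log_iff_exp_le (half_pos hr)).mp ht]
    have h4 := (h2 h3).le
    rw [Real.dist_eq] at h4
    rwa [add_sub_cancel_right]

end LocalBlowupSetup

lemma integral_eq_integral_logPolar (f : E2 → ℝ) :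
    ∫ x, f x = ∫ p in Set.Ioi (0 : ℝ) ×ˢ Set.Ioo (-Real.pi) Real.pi,
      p.1 * f (logPolar (Real.log p.1) p.2) := by
  have h1 := (PiLp.volume_preserving_toLp (Fin 2)).integral_comp
    (MeasurableEquiv.toLp 2 (Fin 2 → ℝ)).measurableEmbedding f
  have h2 := (volume_preserving_finTwoArrow ℝ).symm.integral_comp
    (MeasurableEquiv.finTwoArrow (α := ℝ)).symm.measurableEmbedding
    (fun v : Fin 2 → ℝ => f (WithLp.toLp 2 v))
  rw [← h1, ← h2, ← integral_comp_polarCoord_symm]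
  refine setIntegral_congr_fun polarCoord.open_target.measurableSet fun p hp => ?_
  have hp' : 0 < p.1 := hp.1
  simp only [smul_eq_mul, logPolar, Real.exp_log hp', polarCoord_symm_apply]
  rfl

lemma integral_Ioo_eq_circleMean {f : ℝ → ℝ} (hf : Function.Periodic f (2 * Real.pi)) :
    ∫ q in Set.Ioo (-Real.pi) Real.pi, f q = 2 * Real.pi * circleMean f := by
  have h1 := hf.intervalIntegral_add_eq (-Real.pi) 0
  rw [← integral_Ioc_eq_integral_Ioo, ← intervalIntegral.integral_of_le (by linarith [Real.pi_pos]),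
    ← integral_eq_circleMean, zero_add] at *
  rw [← h1]
  congr 1
  ring

namespace LocalBlowupSetup

variable {n : ℕ} {δ γ : ℝ} {A : Matrix (Fin n) (Fin n) ℝ} {h u : ℕ → Fin n → E2 → ℝ} {M : ℕ → ℝ}

lemma setIntegral_closedBall_eq (hδ : 0 < δ) (f : E2 → ℝ) :
    ∫ x in closedBall (0 : E2) δ, f x =
      ∫ p in Set.Ioc (0 : ℝ) δ ×ˢ Set.Ioo (-Real.pi) Real.pi,
        p.1 * f (logPolar (Real.log p.1) p.2) := by
  rw [← integral_indicator measurableSet_closedBall, integral_eq_integral_logPolar]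
  have h1 : Set.Ioc (0 : ℝ) δ ×ˢ Set.Ioo (-Real.pi) Real.pi =
      (Set.Ioi (0 : ℝ) ×ˢ Set.Ioo (-Real.pi) Real.pi) ∩ (Set.Iic δ ×ˢ Set.univ) := by
    ext p
    simp only [Set.mem_prod, Set.mem_Ioc, Set.mem_Ioo, Set.mem_inter_iff, Set.mem_Ioi,
      Set.mem_Iic, Set.mem_univ, and_true]
    tauto
  rw [h1, ← setIntegral_indicator (measurableSet_Iic.prod MeasurableSet.univ)]
  refine setIntegral_congr_fun (measurableSet_Ioi.prod measurableSet_Ioo) fun p hp => ?_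
  have hp' : 0 < p.1 := hp.1
  by_cases hpd : p.1 ≤ δ
  · have h2 : logPolar (Real.log p.1) p.2 ∈ closedBall (0 : E2) δ :=
      logPolar_mem_closedBall hδ (Real.log_le_log hp' hpd) _
    have h3 : p ∈ Set.Iic δ ×ˢ (Set.univ : Set ℝ) := ⟨hpd, trivial⟩
    simp only [Set.indicator_of_mem h2, Set.indicator_of_mem h3]
  · have h2 : logPolar (Real.log p.1) p.2 ∉ closedBall (0 : E2) δ := by
      rwa [mem_closedBall_zero_iff, norm_logPolar, Real.exp_log hp']
    have h3 : p ∉ Set.Iic δ ×ˢ (Set.univ : Set ℝ) := fun h => hpd h.1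
    simp only [Set.indicator_of_notMem h2, Set.indicator_of_notMem h3, mul_zero]

lemma integrableOn_polar (S : LocalBlowupSetup n δ γ A h u M) (k : ℕ) (i : Fin n) :
    IntegrableOn (fun p : ℝ × ℝ => p.1 * (h k i (logPolar (Real.log p.1) p.2) *
      ‖logPolar (Real.log p.1) p.2‖ ^ (2 * γ) * Real.exp (u k i (logPolar (Real.log p.1) p.2))))
      (Set.Ioc (0 : ℝ) δ ×ˢ Set.Ioo (-Real.pi) Real.pi) := by
  have hγ := S.hγ
  have hms : MeasurableSet (Set.Ioc (0 : ℝ) δ ×ˢ Set.Ioo (-Real.pi) Real.pi) :=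
    measurableSet_Ioc.prod measurableSet_Ioo
  have hmem : ∀ p ∈ Set.Ioc (0 : ℝ) δ ×ˢ Set.Ioo (-Real.pi) Real.pi,
      logPolar (Real.log p.1) p.2 ∈ closedBall (0 : E2) δ := fun p hp =>
    logPolar_mem_closedBall S.hδ (Real.log_le_log hp.1.1 hp.1.2) _
  have hlog : ContinuousOn (fun p : ℝ × ℝ => Real.log p.1)
      (Set.Ioc (0 : ℝ) δ ×ˢ Set.Ioo (-Real.pi) Real.pi) :=
    continuousOn_fst.log fun p hp => hp.1.1.ne'
  have hlp : ContinuousOn (fun p : ℝ × ℝ => logPolar (Real.log p.1) p.2)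
      (Set.Ioc (0 : ℝ) δ ×ˢ Set.Ioo (-Real.pi) Real.pi) :=
    continuous_logPolar.comp_continuousOn (hlog.prodMk continuousOn_snd)
  have hcont : ContinuousOn (fun p : ℝ × ℝ => p.1 * (h k i (logPolar (Real.log p.1) p.2) *
      ‖logPolar (Real.log p.1) p.2‖ ^ (2 * γ) * Real.exp (u k i (logPolar (Real.log p.1) p.2))))
      (Set.Ioc (0 : ℝ) δ ×ˢ Set.Ioo (-Real.pi) Real.pi) := by
    refine continuousOn_fst.mul ((((S.h_c1 k i).continuousOn.comp hlp hmem).mul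
      (hlp.norm.rpow_const fun p _ => Or.inl (norm_ne_zero_iff.mpr (logPolar_ne_zero _ _)))).mul
      ((S.u_cont k i).comp hlp hmem).rexp)
  have hdom : IntegrableOn (fun p : ℝ × ℝ => p.1 ^ (1 + 2 * γ) *
      (S.c₂ * Real.exp ((1 + γ) * M k))) (Set.Ioc (0 : ℝ) δ ×ˢ Set.Ioo (-Real.pi) Real.pi) := by
    rw [IntegrableOn, Measure.volume_eq_prod, ← Measure.prod_restrict]
    refine Integrable.mul_prod (f := fun r : ℝ => r ^ (1 + 2 * γ))
      (g := fun _ : ℝ => S.c₂ * Real.exp ((1 + γ) * M k)) ?_ ?_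
    · exact (intervalIntegral.intervalIntegrable_rpow' (by linarith)).1
    · exact integrableOn_const (by simp)
  refine hdom.mono' (hcont.aestronglyMeasurable hms) ?_
  filter_upwards [ae_restrict_mem hms] with p hp
  have hp' : 0 < p.1 := hp.1.1
  have hx := hmem p hp
  have hh := S.h_lb k i _ hx
  have hc := S.c₁_pos
  have hpos : 0 < h k i (logPolar (Real.log p.1) p.2) := hc.trans_le hh
  rw [norm_logPolar, Real.exp_log hp', Real.norm_of_nonneg (by positivity),
    Real.rpow_add hp', Real.rpow_one]
  have h1 : h k i (logPolar (Real.log p.1) p.2) *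
      Real.exp (u k i (logPolar (Real.log p.1) p.2)) ≤ S.c₂ * Real.exp ((1 + γ) * M k) :=
    mul_le_mul (S.h_ub k i _ hx) (Real.exp_le_exp.mpr (S.M_max k i _ hx)) (Real.exp_pos _).le
      (hc.le.trans (hh.trans (S.h_ub k i _ hx)))
  have h2 : 0 ≤ p.1 * p.1 ^ (2 * γ) := by positivity
  linarith [mul_le_mul_of_nonneg_left h1 h2]

lemma polar_integrand_eq (S : LocalBlowupSetup n δ γ A h u M) {C : ℝ} (hC : S.C ≤ C)
    (hu : ∀ k i, ∀ x ∈ closedBall (0 : E2) δ, x ≠ 0 →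
      u k i x + 2 * (1 + γ) * Real.log ‖x‖ ≤ C) (k : ℕ) (i : Fin n) {r : ℝ} (hr : 0 < r) (q : ℝ) :
    r * (h k i (logPolar (Real.log r) q) * ‖logPolar (Real.log r) q‖ ^ (2 * γ) *
      Real.exp (u k i (logPolar (Real.log r) q))) =
      r⁻¹ * (S.toCylinder hC hu k).F i (Real.log r) q := by
  have h1 := exp_mul_rpow γ (Real.log r) (u k i (logPolar (Real.log r) q))
  simp only [CylinderSolution.F, toCylinder]
  rw [← h1, norm_logPolar, Real.exp_log hr]
  field_simp

lemma setIntegral_polar_eq (S : LocalBlowupSetup n δ γ A h u M) {C : ℝ} (hC : S.C ≤ C)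
    (hu : ∀ k i, ∀ x ∈ closedBall (0 : E2) δ, x ≠ 0 →
      u k i x + 2 * (1 + γ) * Real.log ‖x‖ ≤ C) (k : ℕ) (i : Fin n) {r : ℝ} (hr : 0 < r) :
    ∫ q in Set.Ioo (-Real.pi) Real.pi, r * (h k i (logPolar (Real.log r) q) *
      ‖logPolar (Real.log r) q‖ ^ (2 * γ) * Real.exp (u k i (logPolar (Real.log r) q))) =
      2 * Real.pi * (r⁻¹ * (S.toCylinder hC hu k).Fm i (Real.log r)) := by
  simp only [S.polar_integrand_eq hC hu k i hr, CylinderSolution.Fm]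
  rw [← circleMean_const_mul, integral_Ioo_eq_circleMean]
  intro q
  simp only [CylinderSolution.F, toCylinder, logPolar_periodic _ q]

/-- The local energies of the solution in logarithmic polar coordinates converge to the energy
on the ball. -/
lemma tendsto_σ_toCylinder (S : LocalBlowupSetup n δ γ A h u M) {C : ℝ} (hC : S.C ≤ C)
    (hu : ∀ k i, ∀ x ∈ closedBall (0 : E2) δ, x ≠ 0 →
      u k i x + 2 * (1 + γ) * Real.log ‖x‖ ≤ C) (k : ℕ) (i : Fin n) :
    Tendsto ((S.toCylinder hC hu k).σ i) (nhdsWithin (Real.log δ) (Set.Iio (Real.log δ)))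
      (nhds ((1 / (2 * Real.pi)) *
        ∫ x in closedBall (0 : E2) δ, h k i x * ‖x‖ ^ (2 * γ) * Real.exp (u k i x))) := by
  have hδ := S.hδ
  have hpi := Real.pi_pos
  set D := S.toCylinder hC hu k
  set g : ℝ → ℝ := fun r => r⁻¹ * D.Fm i (Real.log r) with hg
  have hpolar := S.integrableOn_polar k i
  rw [setIntegral_closedBall_eq hδ]
  have hgi : IntegrableOn g (Set.Ioc 0 δ) := by
    rw [IntegrableOn, Measure.volume_eq_prod, ← Measure.prod_restrict] at hpolar
    have h1 := (hpolar.integral_prod_left).const_mul (2 * Real.pi)⁻¹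
    refine h1.congr ?_
    filter_upwards [ae_restrict_mem measurableSet_Ioc] with r hr
    rw [S.setIntegral_polar_eq hC hu k i hr.1, hg]
    field_simp
    rfl
  have hE : (1 / (2 * Real.pi)) * (∫ p in Set.Ioc (0 : ℝ) δ ×ˢ Set.Ioo (-Real.pi) Real.pi,
      p.1 * (h k i (logPolar (Real.log p.1) p.2) * ‖logPolar (Real.log p.1) p.2‖ ^ (2 * γ) *
        Real.exp (u k i (logPolar (Real.log p.1) p.2)))) = ∫ r in (0 : ℝ)..δ, g r := by
    rw [Measure.volume_eq_prod, setIntegral_prod _ hpolar,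
      setIntegral_congr_fun measurableSet_Ioc
        (fun r hr => S.setIntegral_polar_eq hC hu k i hr.1), integral_const_mul,
      intervalIntegral.integral_of_le hδ.le]
    rw [← mul_assoc, one_div, inv_mul_cancel₀ (by positivity), one_mul]
  rw [hE]
  have hσ : ∀ t < Real.log δ, ∫ r in (0 : ℝ)..Real.exp t, g r = D.σ i t := by
    intro t ht
    have htδ : Real.exp t < δ := (Real.lt_log_iff_exp_lt hδ).mp ht
    have hd : ∀ r ∈ Set.Ioc 0 (Real.exp t), HasDerivAt (fun r => D.σ i (Real.log r)) (g r) r := by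
      intro r hr
      have h1 := (D.hasDerivAt_σ S.hH1.2.2.2 i (Real.log_lt_log hr.1 (hr.2.trans_lt htδ))).comp r
        (Real.hasDerivAt_log hr.1.ne')
      rw [mul_comm] at h1
      exact h1
    rw [intervalIntegral.integral_eq_sub_of_hasDerivAt_of_tendsto (Real.exp_pos t)
      (fun r hr => hd r ⟨hr.1, hr.2.le⟩)
      ((intervalIntegrable_iff_integrableOn_Ioc_of_le (Real.exp_pos t).le).mpr
        (hgi.mono_set (Set.Ioc_subset_Ioc_right htδ.le)))
      ((D.tendsto_σ S.c₁_pos S.hH1.2.1 i).comp Real.tendsto_log_nhdsGT_zero)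
      ((hd _ ⟨Real.exp_pos t, le_rfl⟩).continuousAt.tendsto.mono_left nhdsWithin_le_nhds)]
    simp
  have hprim : ContinuousOn (fun x => ∫ r in (0 : ℝ)..x, g r) (Set.Icc 0 δ) :=
    intervalIntegral.continuousOn_primitive_interval
      (by rwa [Set.uIcc_of_le hδ.le, integrableOn_Icc_iff_integrableOn_Ioc]) |>.mono
      (by rw [Set.uIcc_of_le hδ.le])
  have h3 : Tendsto (fun t => ∫ r in (0 : ℝ)..Real.exp t, g r)
      (nhdsWithin (Real.log δ) (Set.Iio (Real.log δ))) (nhds (∫ r in (0 : ℝ)..δ, g r)) := by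
    refine (hprim δ ⟨hδ.le, le_rfl⟩).tendsto.comp (tendsto_nhdsWithin_iff.mpr ⟨?_, ?_⟩)
    · have h4 := Real.continuous_exp.tendsto (Real.log δ)
      rw [Real.exp_log hδ] at h4
      exact h4.mono_left nhdsWithin_le_nhds
    · filter_upwards [self_mem_nhdsWithin] with t ht
      exact ⟨(Real.exp_pos t).le, ((Real.lt_log_iff_exp_lt hδ).mp ht).le⟩
  refine h3.congr' ?_
  filter_upwards [self_mem_nhdsWithin] with t ht using hσ t ht

end LocalBlowupSetup

lemma exists_eq_logPolar {x : E2} (hx : x ≠ 0) : ∃ q, x = logPolar (Real.log ‖x‖) q := by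
  have hx' : 0 < ‖x‖ := norm_pos_iff.mpr hx
  have h1 : ‖(⟨x 0, x 1⟩ : ℂ)‖ = ‖x‖ := by
    rw [Complex.norm_eq_sqrt_sq_add_sq, EuclideanSpace.norm_eq, Fin.sum_univ_two]
    simp
  refine ⟨Complex.arg ⟨x 0, x 1⟩, ?_⟩
  have h2 := Complex.norm_mul_cos_arg ⟨x 0, x 1⟩
  have h3 := Complex.norm_mul_sin_arg ⟨x 0, x 1⟩
  rw [h1] at h2 h3
  ext j
  fin_cases j
  · simpa [logPolar, Real.exp_log hx'] using h2.symm
  · simpa [logPolar, Real.exp_log hx'] using h3.symm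

namespace CylinderSolution

variable {n : ℕ} {A : Matrix (Fin n) (Fin n) ℝ} {μ T₀ c₁ c₂ c₃ C : ℝ}
  (D : CylinderSolution A μ T₀ c₁ c₂ c₃ C)

lemma U_le_u₀ (hA : IsUnit A.det) (hc₁ : 0 < c₁) (hA0 : ∀ i j, 0 ≤ A i j) (i : Fin n) {t : ℝ}
    (ht : t < T₀) (q : ℝ) : D.U i t q ≤ D.u₀ i + oscBound A c₂ C + 2 * μ * t := by
  have h1 := (abs_le.mp (D.abs_U_sub_φ_le i ht.le (D.osc_le hc₁ hA0 i ht.le) q)).2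
  linarith [D.φ_le hA hc₁ hA0 i ht]

end CylinderSolution

namespace LocalBlowupSetup

variable {n : ℕ} {δ γ : ℝ} {A : Matrix (Fin n) (Fin n) ℝ} {h u : ℕ → Fin n → E2 → ℝ} {M : ℕ → ℝ}

/-- Under simple blowup, the components are bounded by their values at the origin up to a uniform
constant. -/
lemma u_le_u_zero (S : LocalBlowupSetup n δ γ A h u M) {C : ℝ} (hC : S.C ≤ C)
    (hu : ∀ k i, ∀ x ∈ closedBall (0 : E2) δ, x ≠ 0 →
      u k i x + 2 * (1 + γ) * Real.log ‖x‖ ≤ C) (k : ℕ) (i : Fin n) {x : E2}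
    (hx : x ∈ closedBall (0 : E2) δ) : u k i x ≤ u k i 0 + oscBound A S.c₂ C := by
  have hδ := S.hδ
  have hball : ∀ y ∈ ball (0 : E2) δ, u k i y ≤ u k i 0 + oscBound A S.c₂ C := by
    intro y hy
    rcases eq_or_ne y 0 with rfl | hy0
    · linarith [(S.toCylinder hC hu k).oscBound_pos S.c₁_pos S.hH1.2.1 i]
    obtain ⟨q, hq⟩ := exists_eq_logPolar hy0
    have h1 := (S.toCylinder hC hu k).U_le_u₀ S.hH1.2.2.2 S.c₁_pos S.hH1.2.1 i
      (Real.log_lt_log (norm_pos_iff.mpr hy0) (mem_ball_zero_iff.mp hy)) q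
    simp only [toCylinder] at h1
    rw [← hq] at h1
    linarith
  rw [← closure_ball (0 : E2) hδ.ne'] at hx
  have hc : ContinuousWithinAt (u k i) (ball (0 : E2) δ) x :=
    (S.u_cont k i x (by rwa [← closure_ball (0 : E2) hδ.ne'])).mono ball_subset_closedBall
  have := mem_closure_iff_nhdsWithin_neBot.mp hx
  refine le_of_tendsto hc ?_
  filter_upwards [self_mem_nhdsWithin] with y hy using hball y hy

end LocalBlowupSetup

/-- in the local blowup setup with simple blowup, if the limit energies
`σᵢ = lim_k (1/2π) ∫_{B_δ} hᵢᵏ |x|^{2γ} e^{ũᵢᵏ}` exist, then they satisfy the Pohozaev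
identity `Σ_{i,j} aᵢⱼ σᵢ σⱼ = 4(1+γ) Σᵢ σᵢ`. -/
theorem limit_energy_pohozaev {n : ℕ} {δ γ : ℝ}
    {A : Matrix (Fin n) (Fin n) ℝ} {h u : ℕ → Fin n → E2 → ℝ} {M : ℕ → ℝ}
    (S : LocalBlowupSetup n δ γ A h u M)
    (hsimple : SimpleBlowup δ γ u)
    (σ : Fin n → ℝ)
    (hσ : ∀ i, Tendsto (fun k => (1/(2*Real.pi)) *
      ∫ x in closedBall (0:E2) δ, h k i x * ‖x‖ ^ (2*γ) * Real.exp (u k i x))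
      atTop (nhds (σ i))) :
    ∑ i, ∑ j, A i j * σ i * σ j = 4*(1+γ) * ∑ i, σ i := by
  obtain ⟨C₁, hC₁⟩ := hsimple
  have hu : ∀ k i, ∀ x ∈ closedBall (0 : E2) δ, x ≠ 0 →
      u k i x + 2 * (1 + γ) * Real.log ‖x‖ ≤ max S.C C₁ :=
    fun k i x hx hx0 => (hC₁ k i x hx hx0).trans (le_max_right _ _)
  have hμ : 0 < 1 + γ := by linarith [S.hγ]
  have hne : (Finset.univ : Finset (Fin n)).Nonempty := ⟨⟨0, S.hn⟩, Finset.mem_univ _⟩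
  refine CylinderSolution.pohozaev_of_tendsto (S.toCylinder (le_max_left _ _) hu)
    S.hH1 S.hH2 S.c₁_pos hμ S.c₃_nonneg
    (N := fun k => Finset.univ.sup' hne fun i => u k i 0)
    (fun k i => Finset.le_sup' (fun i => u k i 0) (Finset.mem_univ i)) (fun k => ?_) ?_
    (S.tendsto_σ_toCylinder (le_max_left _ _) hu) hσ
  · obtain ⟨i, -, hi⟩ := Finset.exists_mem_eq_sup' hne fun i => u k i 0
    exact ⟨i, hi.le⟩
  · refine tendsto_atTop_mono (fun k => ?_) (tendsto_atTop_add_const_right atTop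
      (-oscBound A S.c₂ (max S.C C₁)) (S.M_inf.const_mul_atTop hμ))
    obtain ⟨i, x, hx, hux⟩ := S.M_attained k
    have h1 := S.u_le_u_zero (le_max_left _ _) hu k i hx
    have h2 := Finset.le_sup' (fun i => u k i 0) (Finset.mem_univ i)
    beta_reduce at h2 ⊢
    linarith
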